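/- arXiv:1101.1941 — 13 statements merged into one kernel-verified Lean document; each statement's English description precedes it below -/
import Mathlib

section
/- For every finite rooted tree T_2 in which every internal node has at least two children, every m×n real matrix A, and every map l assigning to each node u of T_2 a leaf l(u) that is a leaf descendant of u (with l(f)=f for every leaf f), the union over all nodes u of T_2 of an optimal 1-d solution for the vector C_{l(u)} − C_{l(p(u))} (taking C_{l(p(root))} := 0), with each weighted row-set crossed with the column set S²_u, is a solution for A. Consequently OPT_2(A) ≤ OPT_1(C_{l(r)}) + Σ_{u ≠ r} OPT_1(C_{l(u)} − C_{l(p(u))}), where r is the root of T_2 and p(u) denotes the parent of u. -/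
/-- A finite rooted tree whose leaves are exactly `Fin m`. -/
structure RTree (m : ℕ) where
  V : Type
  [fin : Fintype V]
  root : V
  parent : V → V
  parent_root : parent root = root
  reaches_root : ∀ v : V, ∃ k : ℕ, parent^[k] v = root
  leaf : Fin m → V
  leaf_inj : Function.Injective leaf
  leaf_iff : ∀ v : V, (∀ u : V, parent u = v → u = v) ↔ ∃ i : Fin m, leaf i = v

attribute [instance] RTree.fin

/-- The set of leaf descendants of a node. -/
def RTree.lset {m : ℕ} (T : RTree m) (v : T.V) : Set (Fin m) :=
  {i | ∃ k : ℕ, T.parent^[k] (T.leaf i) = v}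

/-- Every internal node has at least two children. -/
def RTree.TwoChildren {m : ℕ} (T : RTree m) : Prop :=
  ∀ v : T.V, (∃ u : T.V, u ≠ v ∧ T.parent u = v) →
    ∃ u u' : T.V, u ≠ v ∧ u' ≠ v ∧ u ≠ u' ∧ T.parent u = v ∧ T.parent u' = v

/-- A 1-d solution for the vector `V0`, w.r.t. the tree `T1`. -/
def Sol1 {m : ℕ} (T1 : RTree m) (V0 : Fin m → ℝ) (w : Set (Fin m) → ℝ) : Prop :=
  (Function.support w).Finite ∧
  (∀ s : Set (Fin m), w s ≠ 0 → ∃ u : T1.V, s = T1.lset u) ∧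
  (∀ i : Fin m, ∑ᶠ s ∈ {s : Set (Fin m) | i ∈ s}, w s = V0 i)

noncomputable def Opt1 {m : ℕ} (T1 : RTree m) (V0 : Fin m → ℝ) : ℕ :=
  sInf {k : ℕ | ∃ w : Set (Fin m) → ℝ, Sol1 T1 V0 w ∧ (Function.support w).ncard = k}

/-- A solution for the matrix `A` by weighted allowed rectangles. -/
def Sol2 {m n : ℕ} (T1 : RTree m) (T2 : RTree n) (A : Fin m → Fin n → ℝ)
    (w : Set (Fin m) × Set (Fin n) → ℝ) : Prop :=
  (Function.support w).Finite ∧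
  (∀ p : Set (Fin m) × Set (Fin n), w p ≠ 0 →
      ∃ (u : T1.V) (v : T2.V), p = (T1.lset u, T2.lset v)) ∧
  (∀ (i : Fin m) (j : Fin n),
      ∑ᶠ p ∈ {p : Set (Fin m) × Set (Fin n) | i ∈ p.1 ∧ j ∈ p.2}, w p = A i j)

noncomputable def Opt2 {m n : ℕ} (T1 : RTree m) (T2 : RTree n) (A : Fin m → Fin n → ℝ) : ℕ :=
  sInf {k : ℕ | ∃ w : Set (Fin m) × Set (Fin n) → ℝ,
    Sol2 T1 T2 A w ∧ (Function.support w).ncard = k}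

/-- The vector `V_v` determined by a solution `w`. -/
noncomputable def colVec {m n : ℕ} (T2 : RTree n)
    (w : Set (Fin m) × Set (Fin n) → ℝ) (v : T2.V) : Fin m → ℝ :=
  fun i => ∑ᶠ p ∈ {p : Set (Fin m) × Set (Fin n) | p.2 = T2.lset v ∧ i ∈ p.1}, w p

/-- Combine a family of 1-d weight assignments, crossing the one for node `u` with `S²_u`. -/
noncomputable def combine {m n : ℕ} (T2 : RTree n) (w1 : T2.V → (Set (Fin m) → ℝ)) :
    Set (Fin m) × Set (Fin n) → ℝ :=
  fun p => ∑ᶠ u ∈ {u : T2.V | T2.lset u = p.2}, w1 u p.1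

open scoped Classical in
theorem finsum_mem_eq_sum_ite {α M : Type*} [Fintype α] [AddCommMonoid M] (s : Set α)
    (f : α → M) : ∑ᶠ a ∈ s, f a = ∑ a, if a ∈ s then f a else 0 := by
  rw [finsum_mem_def, finsum_eq_sum_of_fintype]
  rfl

namespace RTree

variable {n : ℕ}

theorem iterate_parent_root (T : RTree n) (k : ℕ) : T.parent^[k] T.root = T.root :=
  Function.iterate_fixed T.parent_root k

/-- Only the root is a proper ancestor of itself. -/
theorem eq_root_of_iterate_parent_parent (T : RTree n) {v : T.V} {k : ℕ}
    (h : T.parent^[k] (T.parent v) = v) : v = T.root := by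
  obtain ⟨N, hN⟩ := T.reaches_root v
  have hper : T.parent^[(k + 1) * N] v = v := by
    rw [Function.iterate_mul]
    exact Function.iterate_fixed h N
  have hsplit : (k + 1) * N = k * N + N := by ring
  rw [hsplit, Function.iterate_add_apply, hN, iterate_parent_root] at hper
  exact hper.symm

open scoped Classical in
/-- Differences along the path from `v` to the root telescope. -/
theorem sum_ancestors_sub (T : RTree n) (g : T.V → ℝ) (v : T.V) :
    (∑ u, if ∃ k : ℕ, T.parent^[k] v = u then
      g u - (if u = T.root then 0 else g (T.parent u)) else 0) = g v := by
  obtain ⟨N, hN⟩ := T.reaches_root v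
  induction N generalizing v with
  | zero =>
    obtain rfl : v = T.root := hN
    have hanc : ∀ u, (∃ k : ℕ, T.parent^[k] T.root = u) ↔ u = T.root := by
      intro u
      simp only [iterate_parent_root, exists_const, eq_comm]
    simp [hanc]
  | succ N ih =>
    by_cases hv : v = T.root
    · exact ih v (by rw [hv, iterate_parent_root])
    have hanc : ∀ u, (if ∃ k : ℕ, T.parent^[k] v = u then
          g u - (if u = T.root then 0 else g (T.parent u)) else 0) =
        (if u = v then g v - g (T.parent v) else 0) +
        if ∃ k : ℕ, T.parent^[k] (T.parent v) = u then
          g u - (if u = T.root then 0 else g (T.parent u)) else 0 := by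
      intro u
      by_cases huv : u = v
      · subst huv
        have hself : ∃ k : ℕ, T.parent^[k] u = u := ⟨0, rfl⟩
        have hproper : ¬ ∃ k : ℕ, T.parent^[k] (T.parent u) = u := fun ⟨_, hk⟩ =>
          hv (T.eq_root_of_iterate_parent_parent hk)
        simp only [if_pos hself, if_neg hproper, if_neg hv, if_true, add_zero]
      · have hiff : (∃ k : ℕ, T.parent^[k] v = u) ↔
            ∃ k : ℕ, T.parent^[k] (T.parent v) = u := by
          constructor
          · rintro ⟨_ | k, hk⟩
            · exact absurd hk.symm huv
            · exact ⟨k, hk⟩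
          · rintro ⟨k, hk⟩
            exact ⟨k + 1, hk⟩
        simp only [hiff, if_neg huv, zero_add]
    rw [Finset.sum_congr rfl fun u _ => hanc u, Finset.sum_add_distrib,
      ih (T.parent v) hN]
    simp

end RTree

open scoped Classical in
theorem finsum_combine_eq_sum {m n : ℕ} (T : RTree n) (w : T.V → Set (Fin m) → ℝ)
    (i : Fin m) (j : Fin n) :
    ∑ᶠ p ∈ {p : Set (Fin m) × Set (Fin n) | i ∈ p.1 ∧ j ∈ p.2}, combine T w p =
      ∑ u, if j ∈ T.lset u then ∑ᶠ s ∈ {s : Set (Fin m) | i ∈ s}, w u s else 0 := by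
  simp only [combine, finsum_mem_eq_sum_ite]
  simp only [Set.mem_ofPred_eq]
  calc
    _ = ∑ p : Set (Fin m) × Set (Fin n), ∑ u, if T.lset u = p.2 then
          (if j ∈ T.lset u then (if i ∈ p.1 then w u p.1 else 0) else 0) else 0 := by
      refine Finset.sum_congr rfl fun p _ => ?_
      by_cases h : i ∈ p.1 ∧ j ∈ p.2
      · rw [if_pos h]
        refine Finset.sum_congr rfl fun u _ => ?_
        by_cases hu : T.lset u = p.2
        · simp [hu, h]
        · simp [hu]
      · rw [if_neg h]
        refine (Finset.sum_eq_zero fun u _ => ?_).symm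
        by_cases hu : T.lset u = p.2
        · rw [if_pos hu, hu]
          split_ifs <;> tauto
        · simp [hu]
    _ = _ := by
      rw [Finset.sum_comm]
      refine Finset.sum_congr rfl fun u _ => ?_
      rw [Fintype.sum_prod_type]
      simp only [Finset.sum_ite_eq, Finset.mem_univ, if_true]
      split_ifs <;> simp

theorem support_combine_subset {m n : ℕ} (T : RTree n) (w : T.V → Set (Fin m) → ℝ) :
    Function.support (combine T w) ⊆
      ⋃ u, (fun s => (s, T.lset u)) '' Function.support (w u) := by
  intro p hp
  obtain ⟨u, hu, hne⟩ := exists_ne_zero_of_finsum_mem_ne_zero hp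
  exact Set.mem_iUnion.2 ⟨u, p.1, hne, Prod.ext rfl hu⟩

theorem ncard_support_combine_le {m n : ℕ} (T : RTree n) (w : T.V → Set (Fin m) → ℝ) :
    (Function.support (combine T w)).ncard ≤ ∑ u, (Function.support (w u)).ncard := by
  refine (Set.ncard_le_ncard (support_combine_subset T w)).trans ?_
  refine (Set.ncard_iUnion_le_of_fintype _).trans ?_
  exact Finset.sum_le_sum fun u _ => Set.ncard_image_le

open scoped Classical in
/-- the union, over nodes `u` of `T₂`, of an optimal 1-d solution for
`C_{l(u)} - C_{l(p(u))}` (with `C_{l(p(root))} := 0`) crossed with `S²_u` is a solution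
for `A`; consequently `OPT₂(A) ≤ OPT₁(C_{l(r)}) + ∑_{u ≠ r} OPT₁(C_{l(u)} - C_{l(p(u))})`. -/
theorem stmt0 {m n : ℕ} (A : Fin m → Fin n → ℝ) (T1 : RTree m) (T2 : RTree n)
    (hT2 : T2.TwoChildren)
    (l : T2.V → Fin n)
    (hl : ∀ u : T2.V, l u ∈ T2.lset u)
    (hlf : ∀ f : Fin n, l (T2.leaf f) = f)
    (w1 : T2.V → (Set (Fin m) → ℝ))
    (hw1 : ∀ u : T2.V,
      Sol1 T1 (fun i => A i (l u) - if u = T2.root then 0 else A i (l (T2.parent u))) (w1 u) ∧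
      (Function.support (w1 u)).ncard =
        Opt1 T1 (fun i => A i (l u) - if u = T2.root then 0 else A i (l (T2.parent u)))) :
    Sol2 T1 T2 A (combine T2 w1) ∧
    Opt2 T1 T2 A ≤ Opt1 T1 (fun i => A i (l T2.root)) +
      ∑ᶠ u ∈ {u : T2.V | u ≠ T2.root},
        Opt1 T1 (fun i => A i (l u) - A i (l (T2.parent u))) := by
  have hsol : Sol2 T1 T2 A (combine T2 w1) := by
    refine ⟨Set.toFinite _, fun p hp => ?_, fun i j => ?_⟩
    · obtain ⟨v, s, hs, rfl⟩ := Set.mem_iUnion.1 (support_combine_subset T2 w1 hp)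
      obtain ⟨u, rfl⟩ := (hw1 v).1.2.1 s hs
      exact ⟨u, v, rfl⟩
    · rw [finsum_combine_eq_sum]
      simp only [fun u => (hw1 u).1.2.2 i]
      exact (T2.sum_ancestors_sub (fun u => A i (l u)) (T2.leaf j)).trans (by rw [hlf])
  refine ⟨hsol, ?_⟩
  calc
    Opt2 T1 T2 A ≤ (Function.support (combine T2 w1)).ncard := Nat.sInf_le ⟨_, hsol, rfl⟩
    _ ≤ ∑ u, (Function.support (w1 u)).ncard := ncard_support_combine_le T2 w1
    _ = _ := by
      rw [finsum_mem_eq_sum_ite, ← Finset.add_sum_erase _ _ (Finset.mem_univ T2.root),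
        ← Finset.sum_erase Finset.univ (a := T2.root) (by simp)]
      simp only [fun u => (hw1 u).2, if_true, sub_zero, Set.mem_ofPred_eq]
      congr 1
      refine Finset.sum_congr rfl fun u hu => ?_
      have hur : u ≠ T2.root := Finset.ne_of_mem_erase hu
      simp only [if_pos hur, if_neg hur]
end

section
/- For every m×n real matrix A, with T_1, T_2 rooted trees on the rows and columns as above, there exists a map l assigning to each node u of T_2 a leaf l(u) that is a leaf descendant of u (with l(f)=f for every leaf f) such that OPT_1(C_{l(r)}) + Σ_{u ≠ r} OPT_1(C_{l(u)} − C_{l(p(u))}) ≤ 2·OPT_2(A), where r is the root of T_2 and p(u) denotes the parent of u. (This is the deterministic content of the 2-approximation theorem for Tree×Tree.) -/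
/-- A `finsum` over a set in a finite type is a sum over a filtered `Finset.univ`. -/
theorem finsum_mem_setOf_eq_sum_filter {α M : Type*} [Fintype α] [AddCommMonoid M]
    (p : α → Prop) [DecidablePred p] (f : α → M) :
    ∑ᶠ a ∈ {a | p a}, f a = ∑ a with p a, f a := by
  rw [← finsum_mem_coe_finset]
  simp

/-- Let every node pick as its heavy predecessor `h u` one whose own heavy path has least
weight: `l u` is the label of the end of the heavy path from `u`, and `D u` its total weight. -/
theorem exists_heavy_path {V β : Type*} [Finite V] (r : V → V → Prop) (hr : WellFounded r)
    (base : V → β) (k : V → ℕ) :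
    ∃ (l : V → β) (D : V → ℕ) (h : V → V),
      (∀ u, (∃ c, r c u) → r (h u) u ∧ (∀ c, r c u → D (h u) ≤ D c) ∧ l u = l (h u) ∧
        D u = k u + D (h u)) ∧
      ∀ u, (¬∃ c, r c u) → l u = base u ∧ D u = k u := by
  classical
  have hmin : ∀ (u : V) (g : ∀ c, r c u → β × ℕ), (∃ c, r c u) →
      ∃ c, ∃ hc : r c u, ∀ c' (hc' : r c' u), (g c hc).2 ≤ (g c' hc').2 := by
    rintro u g ⟨c, hc⟩
    have : Nonempty {c // r c u} := ⟨⟨c, hc⟩⟩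
    obtain ⟨⟨a, ha⟩, hm⟩ := Finite.exists_min (fun c : {c // r c u} => (g c.1 c.2).2)
    exact ⟨a, ha, fun c' hc' => hm ⟨c', hc'⟩⟩
  choose a ha ham using hmin
  let step : ∀ u, (∀ c, r c u → β × ℕ) → β × ℕ := fun u g =>
    if hu : ∃ c, r c u then
      ((g (a u g hu) (ha u g hu)).1, k u + (g (a u g hu) (ha u g hu)).2)
    else (base u, k u)
  let P : V → β × ℕ := hr.fix step
  have hP : ∀ u, P u = step u (fun c _ => P c) := fun u => hr.fix_eq step u
  refine ⟨fun u => (P u).1, fun u => (P u).2,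
    fun u => if hu : ∃ c, r c u then a u (fun c _ => P c) hu else u, ?_, ?_⟩
  · intro u hu
    simp only [dif_pos hu]
    refine ⟨ha u _ hu, ham u (fun c _ => P c) hu, ?_, ?_⟩
    · rw [hP u]; simp only [step, dif_pos hu]
    · rw [hP u]; simp only [step, dif_pos hu]
  · intro u hu
    simp only [hP u, step, dif_neg hu, and_self]

namespace RTree

variable {m : ℕ} (T : RTree m)

open scoped Classical in
/-- The distance of a node from the root. -/
noncomputable def depth (v : T.V) : ℕ := Nat.find (T.reaches_root v)

theorem depth_parent_lt {v : T.V} (hv : v ≠ T.root) : T.depth (T.parent v) < T.depth v := by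
  classical
  have hs : T.parent^[T.depth v] v = T.root := Nat.find_spec (T.reaches_root v)
  cases hd : T.depth v with
  | zero => rw [hd] at hs; exact absurd hs hv
  | succ d =>
    rw [hd, Function.iterate_succ_apply] at hs
    exact Nat.lt_succ_of_le (Nat.find_min' (T.reaches_root (T.parent v)) hs)

theorem depth_parent_le (v : T.V) : T.depth (T.parent v) ≤ T.depth v := by
  by_cases hv : v = T.root
  · rw [hv, T.parent_root]
  · exact (T.depth_parent_lt hv).le

theorem depth_iterate_parent_le (k : ℕ) (v : T.V) : T.depth (T.parent^[k] v) ≤ T.depth v := by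
  induction k with
  | zero => exact le_rfl
  | succ k ih =>
    rw [Function.iterate_succ_apply']
    exact (T.depth_parent_le _).trans ih

/-- `c` is a child of `v`. -/
def IsChild (c v : T.V) : Prop := c ≠ v ∧ T.parent c = v

theorem IsChild.ne_root {c v : T.V} (h : T.IsChild c v) : c ≠ T.root := by
  rintro rfl
  exact h.1 (T.parent_root.symm.trans h.2)

theorem isChild_parent {v : T.V} (hv : v ≠ T.root) : T.IsChild v (T.parent v) :=
  ⟨fun h => (T.depth_parent_lt hv).ne (congrArg T.depth h.symm), rfl⟩

theorem wellFounded_isChild : WellFounded T.IsChild := by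
  have hwf : WellFounded (fun a b : T.V => T.depth b < T.depth a) := by
    have : IsTrans T.V (fun a b => T.depth b < T.depth a) := ⟨fun _ _ _ h h' => h'.trans h⟩
    have : Std.Irrefl (fun a b : T.V => T.depth b < T.depth a) := ⟨fun _ => lt_irrefl _⟩
    exact Finite.wellFounded_of_trans_of_irrefl _
  exact Subrelation.wf (fun {c v} h => h.2 ▸ T.depth_parent_lt (IsChild.ne_root T h)) hwf

theorem exists_leaf_of_not_exists_isChild {v : T.V} (h : ¬∃ c, T.IsChild c v) :
    ∃ i, T.leaf i = v :=
  (T.leaf_iff v).1 fun u hu => by_contra fun hne => h ⟨u, hne, hu⟩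

theorem not_exists_isChild_leaf (i : Fin m) : ¬∃ c, T.IsChild c (T.leaf i) := by
  rintro ⟨c, hne, hc⟩
  exact hne ((T.leaf_iff _).2 ⟨i, rfl⟩ c hc)

theorem lset_leaf (i : Fin m) : T.lset (T.leaf i) = {i} := by
  have key : ∀ k x, T.parent^[k] x = T.leaf i → x = T.leaf i := by
    intro k
    induction k with
    | zero => exact fun x h => h
    | succ k ih => exact fun x h => (T.leaf_iff _).2 ⟨i, rfl⟩ x (ih _ h)
  ext j
  exact ⟨fun ⟨k, hk⟩ => T.leaf_inj (key k _ hk), fun h => ⟨0, congrArg T.leaf h⟩⟩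

theorem lset_subset_lset_parent (v : T.V) : T.lset v ⊆ T.lset (T.parent v) := by
  rintro i ⟨k, hk⟩
  exact ⟨k + 1, by rw [Function.iterate_succ_apply', hk]⟩

open scoped Classical in
/-- The sum of `X` over all ancestors of `v`, including `v`. -/
noncomputable def ancestorSum {M : Type*} [AddCommMonoid M] (X : T.V → M) (v : T.V) : M :=
  ∑ x with ∃ k : ℕ, T.parent^[k] v = x, X x

theorem ancestorSum_root {M : Type*} [AddCommMonoid M] (X : T.V → M) :
    T.ancestorSum X T.root = X T.root := by
  classical
  have h : ∀ k : ℕ, T.parent^[k] T.root = T.root := fun k => Function.iterate_fixed T.parent_root k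
  simp [ancestorSum, h, Finset.filter_eq]

theorem ancestorSum_of_ne_root {M : Type*} [AddCommMonoid M] (X : T.V → M) {v : T.V}
    (hv : v ≠ T.root) : T.ancestorSum X v = X v + T.ancestorSum X (T.parent v) := by
  classical
  unfold ancestorSum
  rw [← Finset.sum_insert (s := Finset.univ.filter _)]
  · congr 1
    ext x
    simp only [Finset.mem_filter, Finset.mem_univ, true_and, Finset.mem_insert]
    constructor
    · rintro ⟨_ | k, hk⟩
      · exact Or.inl hk.symm
      · exact Or.inr ⟨k, hk⟩
    · rintro (rfl | ⟨k, hk⟩)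
      · exact ⟨0, rfl⟩
      · exact ⟨k + 1, hk⟩
  · simp only [Finset.mem_filter, Finset.mem_univ, true_and]
    rintro ⟨k, hk⟩
    have h1 := T.depth_iterate_parent_le k (T.parent v)
    rw [hk] at h1
    exact absurd (T.depth_parent_lt hv) h1.not_gt

/-- The heavy paths partition the nodes: the weights `D` of the heavy paths starting at nodes that
are not heavy children add up to the total weight. -/
theorem sum_heavy_path (k D : T.V → ℕ) (h : T.V → T.V)
    (hint : ∀ u, (∃ c, T.IsChild c u) → T.IsChild (h u) u ∧ D u = k u + D (h u))
    (hleaf : ∀ u, (¬∃ c, T.IsChild c u) → D u = k u) [DecidableEq T.V] :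
    ∑ u, (if u ≠ T.root ∧ h (T.parent u) = u then 0 else D u) = ∑ u, k u := by
  classical
  have h1 : ∑ u, D u = ∑ u, k u + ∑ u with ∃ c, T.IsChild c u, D (h u) := by
    rw [Finset.sum_filter, ← Finset.sum_add_distrib]
    refine Finset.sum_congr rfl fun u _ => ?_
    split_ifs with hu
    · exact (hint u hu).2
    · exact hleaf u hu
  have h2 : ∑ u with ∃ c, T.IsChild c u, D (h u) =
      ∑ u with u ≠ T.root ∧ h (T.parent u) = u, D u := by
    refine Finset.sum_nbij' h T.parent ?_ ?_ ?_ ?_ fun _ _ => rfl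
    · intro u hu
      have hc := (hint u (by simpa using hu)).1
      simpa using ⟨IsChild.ne_root T hc, by rw [hc.2]⟩
    · intro u hu
      have hu' : u ≠ T.root ∧ h (T.parent u) = u := by simpa using hu
      simpa using ⟨u, T.isChild_parent hu'.1⟩
    · intro u hu
      exact (hint u (by simpa using hu)).1.2
    · intro u hu
      exact (Finset.mem_filter.1 hu).2.2
  have h3 : ∑ u, D u = ∑ u with u ≠ T.root ∧ h (T.parent u) = u, D u +
      ∑ u, (if u ≠ T.root ∧ h (T.parent u) = u then 0 else D u) := by
    rw [Finset.sum_filter, ← Finset.sum_add_distrib]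
    refine Finset.sum_congr rfl fun u _ => ?_
    split_ifs <;> simp
  omega

open scoped Classical in
/-- Summing over the nodes, each leaf set counted at one representative node only, is summing over
all leaf sets. -/
theorem exists_rep_sum :
    ∃ R : T.V → Prop, ∀ {M : Type} [AddCommMonoid M] (g : Set (Fin m) → M),
      (∀ S, g S ≠ 0 → ∃ v, S = T.lset v) → ∑ v with R v, g (T.lset v) = ∑ S, g S := by
  have hrep : ∀ v, ∃ x, T.lset x = T.lset v := fun v => ⟨v, rfl⟩
  let ρ : Set (Fin m) → T.V := fun S => if h : ∃ x, T.lset x = S then h.choose else T.root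
  have hρ : ∀ v, T.lset (ρ (T.lset v)) = T.lset v := by
    intro v
    simp only [ρ, dif_pos (hrep v)]
    exact (hrep v).choose_spec
  refine ⟨fun v => ρ (T.lset v) = v, fun {M} _ g hg => ?_⟩
  refine Finset.sum_of_injOn T.lset ?_ (fun _ _ => Finset.mem_coe.2 (Finset.mem_univ _)) ?_
    fun _ _ => rfl
  · intro x hx y hy hxy
    have hx' : ρ (T.lset x) = x := by simpa using hx
    have hy' : ρ (T.lset y) = y := by simpa using hy
    rw [← hx', ← hy', hxy]
  · intro S _ hS
    by_contra hne
    obtain ⟨v, rfl⟩ := hg S hne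
    exact hS ⟨ρ (T.lset v), by simp [hρ], hρ v⟩

end RTree

/-- `X` has a 1-d solution of size at most `c`. -/
def HasSol1 {m : ℕ} (T1 : RTree m) (X : Fin m → ℝ) (c : ℕ) : Prop :=
  ∃ w : Set (Fin m) → ℝ, Sol1 T1 X w ∧ (Function.support w).ncard ≤ c

namespace HasSol1

variable {m : ℕ} {T1 : RTree m} {X Y : Fin m → ℝ} {a b : ℕ}

theorem opt1_le (h : HasSol1 T1 X a) : Opt1 T1 X ≤ a := by
  obtain ⟨w, hw, hc⟩ := h
  exact le_trans (Nat.sInf_le ⟨w, hw, rfl⟩) hc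

theorem zero : HasSol1 T1 (fun _ => 0) 0 :=
  ⟨0, ⟨Set.toFinite _, fun _ h => absurd rfl h, fun i => by simp⟩, by simp⟩

theorem neg (hX : HasSol1 T1 X a) : HasSol1 T1 (-X) a := by
  obtain ⟨w, ⟨_, hw, hs⟩, hc⟩ := hX
  refine ⟨-w, ⟨Set.toFinite _, fun s h => hw s (by simpa using h), fun i => ?_⟩, ?_⟩
  · rw [Pi.neg_apply, ← hs i, ← finsum_mem_neg_distrib _ (Set.toFinite _)]
    rfl
  · rwa [Function.support_neg]

theorem add (hX : HasSol1 T1 X a) (hY : HasSol1 T1 Y b) : HasSol1 T1 (X + Y) (a + b) := by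
  obtain ⟨w, ⟨_, hw, hs⟩, hc⟩ := hX
  obtain ⟨w', ⟨_, hw', hs'⟩, hc'⟩ := hY
  refine ⟨w + w', ⟨Set.toFinite _, fun s h => ?_, fun i => ?_⟩, ?_⟩
  · by_cases h0 : w s = 0
    · exact hw' s fun h0' => h (by simp [h0, h0'])
    · exact hw s h0
  · rw [Pi.add_apply, ← hs i, ← hs' i, ← finsum_mem_add_distrib (Set.toFinite _)]
    rfl
  · calc (Function.support (w + w')).ncard
        ≤ (Function.support w ∪ Function.support w').ncard :=
          Set.ncard_le_ncard (Function.support_add _ _) (Set.toFinite _)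
      _ ≤ _ := (Set.ncard_union_le _ _).trans (add_le_add hc hc')

theorem sub (hX : HasSol1 T1 X a) (hY : HasSol1 T1 Y b) : HasSol1 T1 (X - Y) (a + b) := by
  rw [sub_eq_add_neg]
  exact hX.add hY.neg

end HasSol1

/-- Single cells are allowed rectangles, so every matrix has a solution. -/
theorem exists_sol2 {m n : ℕ} (T1 : RTree m) (T2 : RTree n) (A : Fin m → Fin n → ℝ) :
    ∃ w, Sol2 T1 T2 A w := by
  classical
  refine ⟨fun p => ∑ i, ∑ j, if p = ({i}, {j}) then A i j else 0, Set.toFinite _, ?_, ?_⟩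
  · intro p hp
    obtain ⟨i, _, hi⟩ := Finset.exists_ne_zero_of_sum_ne_zero hp
    obtain ⟨j, _, hj⟩ := Finset.exists_ne_zero_of_sum_ne_zero hi
    refine ⟨T1.leaf i, T2.leaf j, ?_⟩
    rw [T1.lset_leaf, T2.lset_leaf]
    exact by_contra fun h => hj (if_neg h)
  · intro i j
    rw [finsum_mem_setOf_eq_sum_filter, Finset.sum_comm, Finset.sum_eq_single i]
    · rw [Finset.sum_comm, Finset.sum_eq_single j]
      · simp
      · intro j' _ hj
        simp [hj.symm]
      · simp
    · intro i' _ hi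
      refine Finset.sum_eq_zero fun p hp => Finset.sum_eq_zero fun j' _ => if_neg ?_
      rintro rfl
      exact hi.symm (by simpa using (Finset.mem_filter.1 hp).2.1)
    · simp

open scoped Classical in
/-- The rectangles of a solution, grouped by the node of `T2` giving their column set. -/
theorem Sol2.exists_grouping {m n : ℕ} {T1 : RTree m} {T2 : RTree n} {A : Fin m → Fin n → ℝ}
    {w : Set (Fin m) × Set (Fin n) → ℝ} (hw : Sol2 T1 T2 A w) :
    ∃ (X : T2.V → Fin m → ℝ) (k : T2.V → ℕ), (∀ v, HasSol1 T1 (X v) (k v)) ∧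
      (∀ i j, ∑ v with j ∈ T2.lset v, X v i = A i j) ∧
      ∑ v, k v = (Function.support w).ncard := by
  obtain ⟨R, hR⟩ := T2.exists_rep_sum
  obtain ⟨_, hall, hsum⟩ := hw
  let W : T2.V → Set (Fin m) → ℝ := fun v s => if R v then w (s, T2.lset v) else 0
  refine ⟨fun v i => ∑ᶠ s ∈ {s : Set (Fin m) | i ∈ s}, W v s,
    fun v => (Function.support (W v)).ncard, ?_, ?_, ?_⟩
  · refine fun v => ⟨W v, ⟨Set.toFinite _, fun s hs => ?_, fun i => rfl⟩, le_rfl⟩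
    obtain ⟨u, v', h⟩ := hall (s, T2.lset v) fun h0 => hs (by simp [W, h0])
    exact ⟨u, congrArg Prod.fst h⟩
  · intro i j
    rw [← hsum i j, finsum_mem_setOf_eq_sum_filter, Finset.sum_filter, Finset.sum_filter,
      Fintype.sum_prod_type_right, ← hR, Finset.sum_filter]
    · refine Finset.sum_congr rfl fun v _ => ?_
      simp only [finsum_mem_setOf_eq_sum_filter, Finset.sum_filter]
      by_cases hv : R v <;> by_cases hj : j ∈ T2.lset v <;> simp [W, hv, hj]
    · intro S hS
      obtain ⟨s, _, hs⟩ := Finset.exists_ne_zero_of_sum_ne_zero hS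
      obtain ⟨u, v, h⟩ := hall (s, S) fun h0 => hs (by simp [h0])
      exact ⟨v, congrArg Prod.snd h⟩
  · have hcard : ∀ {α : Type} [Fintype α] (f : α → ℝ),
        (Function.support f).ncard = ∑ a, if f a ≠ 0 then 1 else 0 := by
      intro α _ f
      rw [Set.ncard_eq_toFinset_card', ← Finset.card_filter]
      congr 1
      ext a
      simp
    rw [hcard, Fintype.sum_prod_type_right, ← hR, Finset.sum_filter]
    · refine Finset.sum_congr rfl fun v _ => ?_
      simp only [hcard]
      by_cases hv : R v <;> simp [W, hv]
    · intro S hS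
      obtain ⟨s, _, hs⟩ := Finset.exists_ne_zero_of_sum_ne_zero hS
      obtain ⟨u, v, h⟩ := hall (s, S) fun h0 => hs (by simp [h0])
      exact ⟨v, congrArg Prod.snd h⟩

/-- there exists a choice of leaf descendants `l` such that
`OPT₁(C_{l(r)}) + ∑_{u ≠ r} OPT₁(C_{l(u)} - C_{l(p(u))}) ≤ 2·OPT₂(A)`. -/
theorem stmt1 {m n : ℕ} (A : Fin m → Fin n → ℝ) (T1 : RTree m) (T2 : RTree n)
    (hT2 : T2.TwoChildren) :
    ∃ l : T2.V → Fin n,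
      (∀ u : T2.V, l u ∈ T2.lset u) ∧
      (∀ f : Fin n, l (T2.leaf f) = f) ∧
      Opt1 T1 (fun i => A i (l T2.root)) +
        ∑ᶠ u ∈ {u : T2.V | u ≠ T2.root},
          Opt1 T1 (fun i => A i (l u) - A i (l (T2.parent u))) ≤
      2 * Opt2 T1 T2 A := by
  classical
  obtain ⟨w, hw, hcard⟩ := Nat.sInf_mem (s := {k : ℕ | ∃ w : Set (Fin m) × Set (Fin n) → ℝ,
      Sol2 T1 T2 A w ∧ (Function.support w).ncard = k})
    ((exists_sol2 T1 T2 A).imp' _ fun w hw => ⟨w, hw, rfl⟩)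
  change _ = Opt2 T1 T2 A at hcard
  obtain ⟨X, k, hX, hA, hk⟩ := hw.exists_grouping
  have hbase : ∀ u, ∃ i, (¬∃ c, T2.IsChild c u) → T2.leaf i = u := by
    have : Nonempty (Fin n) := by
      obtain ⟨u, -, hu⟩ := T2.wellFounded_isChild.has_min Set.univ ⟨T2.root, trivial⟩
      obtain ⟨i, -⟩ := T2.exists_leaf_of_not_exists_isChild fun ⟨c, hc⟩ => hu c trivial hc
      exact ⟨i⟩
    intro u
    by_cases hu : ∃ c, T2.IsChild c u
    · exact ⟨Classical.arbitrary _, fun h => absurd hu h⟩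
    · exact (T2.exists_leaf_of_not_exists_isChild hu).imp fun _ h _ => h
  choose base hbase using hbase
  obtain ⟨l, D, h, hint, hleaf⟩ := exists_heavy_path T2.IsChild T2.wellFounded_isChild base k
  have hl_leaf : ∀ u, (¬∃ c, T2.IsChild c u) → T2.leaf (l u) = u := fun u hu => by
    rw [(hleaf u hu).1, hbase u hu]
  have hcol : ∀ j, (fun i => A i j) = T2.ancestorSum X (T2.leaf j) := by
    intro j
    ext i
    rw [← hA i j, RTree.ancestorSum, Finset.sum_apply]
    rfl
  have hpath : ∀ u, HasSol1 T1 ((fun i => A i (l u)) - T2.ancestorSum X u + X u) (D u) := by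
    intro u
    induction u using T2.wellFounded_isChild.induction with
    | _ u ih =>
      by_cases hu : ∃ c, T2.IsChild c u
      · obtain ⟨hc, -, hl, hD⟩ := hint u hu
        have hanc := T2.ancestorSum_of_ne_root X (RTree.IsChild.ne_root T2 hc)
        rw [hc.2] at hanc
        have hadd := (hX u).add (ih (h u) hc)
        rw [hanc] at hadd
        rw [hD, hl]
        convert hadd using 1
        abel
      · rw [hcol, hl_leaf u hu, sub_self, zero_add, (hleaf u hu).2]
        exact hX u
  have hroot : Opt1 T1 (fun i => A i (l T2.root)) ≤ 2 * D T2.root := by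
    have hr := hpath T2.root
    rw [T2.ancestorSum_root, sub_add_cancel] at hr
    exact hr.opt1_le.trans (by omega)
  have hedge : ∀ u, u ≠ T2.root → Opt1 T1 (fun i => A i (l u) - A i (l (T2.parent u))) ≤
      2 * if u ≠ T2.root ∧ h (T2.parent u) = u then 0 else D u := by
    intro u hu
    obtain ⟨hc, hmin, hl, -⟩ := hint _ ⟨u, T2.isChild_parent hu⟩
    split_ifs with hh
    · rw [hl, hh.2]
      simpa using (HasSol1.zero (T1 := T1)).opt1_le
    · have hsub := (hpath u).sub (hpath (h (T2.parent u)))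
      rw [T2.ancestorSum_of_ne_root X hu,
        T2.ancestorSum_of_ne_root X (RTree.IsChild.ne_root T2 hc), hc.2, ← hl] at hsub
      have hle := hmin u (T2.isChild_parent hu)
      refine le_trans (HasSol1.opt1_le ?_) (show D u + D (h (T2.parent u)) ≤ _ by omega)
      convert hsub using 1
      ext i
      simp only [Pi.sub_apply, Pi.add_apply]
      ring
  refine ⟨l, fun u => ?_, fun f => T2.leaf_inj (hl_leaf _ (T2.not_exists_isChild_leaf f)), ?_⟩
  · induction u using T2.wellFounded_isChild.induction with
    | _ u ih =>
      by_cases hu : ∃ c, T2.IsChild c u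
      · obtain ⟨hc, -, hl, -⟩ := hint u hu
        have hmem := T2.lset_subset_lset_parent _ (ih (h u) hc)
        rwa [hc.2, ← hl] at hmem
      · exact ⟨0, hl_leaf u hu⟩
  · rw [finsum_mem_setOf_eq_sum_filter, ← hcard, ← hk,
      ← T2.sum_heavy_path k D h (fun u hu => ⟨(hint u hu).1, (hint u hu).2.2.2⟩)
        (fun u hu => (hleaf u hu).2),
      Finset.mul_sum, ← Finset.add_sum_erase _ _ (Finset.mem_univ T2.root), Finset.filter_ne']
    refine add_le_add ?_ (Finset.sum_le_sum fun u hu => hedge u (Finset.ne_of_mem_erase hu))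
    simpa using hroot
end

section
/- For any optimal solution for A (a solution whose number of weighted rectangles is exactly OPT_2(A)), with V_v defined from that solution for each node v of T_2, one has Σ_{v ∈ T_2} OPT_1(V_v) = OPT_2(A); moreover the union over all nodes v of T_2 of an optimal 1-d solution for V_v, with each weighted row-set crossed with S²_v, is again an optimal solution for A. -/
open Function in
/-- A node fixed by a positive iterate of `parent` is the root. -/
theorem RTree.eq_root_of_iterate_eq {m : ℕ} (T : RTree m) {x : T.V} {k : ℕ} (hk : 0 < k)
    (h : T.parent^[k] x = x) : x = T.root := by
  obtain ⟨N, hN⟩ := T.reaches_root x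
  have hper : IsPeriodicPt T.parent (k * N) x := IsPeriodicPt.mul_const h N
  obtain ⟨d, hd⟩ := Nat.exists_eq_add_of_le (Nat.le_mul_of_pos_left N hk)
  have : T.parent^[k * N] x = T.root := by
    rw [hd, add_comm, iterate_add_apply, hN, iterate_fixed T.parent_root]
  exact hper.symm.trans this

theorem RTree.ancestor_antisymm {m : ℕ} (T : RTree m) {x y : T.V} {a b : ℕ}
    (hxy : T.parent^[a] x = y) (hyx : T.parent^[b] y = x) : x = y := by
  rcases Nat.eq_zero_or_pos a with rfl | ha
  · exact hxy
  · have hx : x = T.root := T.eq_root_of_iterate_eq (k := b + a) (by omega) (by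
      rw [Function.iterate_add_apply, hxy, hyx])
    rw [← hxy, hx, Function.iterate_fixed T.parent_root]

theorem RTree.lset_nonempty {m : ℕ} (T : RTree m) (v : T.V) : (T.lset v).Nonempty := by
  let r : T.V → T.V → Prop := fun x y => x ≠ y ∧ ∃ k : ℕ, T.parent^[k] x = y
  have : IsTrans T.V r := ⟨by
    rintro x y z ⟨hxy, a, ha⟩ ⟨-, b, hb⟩
    refine ⟨?_, b + a, by rw [Function.iterate_add_apply, ha, hb]⟩
    rintro rfl
    exact hxy (T.ancestor_antisymm ha hb)⟩
  have : Std.Irrefl r := ⟨fun x hx => hx.1 rfl⟩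
  induction v using (Finite.wellFounded_of_trans_of_irrefl r).induction with
  | _ v ih =>
    by_cases hv : ∀ u : T.V, T.parent u = v → u = v
    · obtain ⟨i, hi⟩ := (T.leaf_iff v).1 hv
      exact ⟨i, 0, hi⟩
    · push Not at hv
      obtain ⟨u, hu, hne⟩ := hv
      obtain ⟨i, k, hk⟩ := ih u ⟨hne, 1, hu⟩
      exact ⟨i, k + 1, by rw [Function.iterate_succ_apply', hk, hu]⟩

/-- Two ancestors of the same node are comparable. -/
theorem RTree.ancestor_total {m : ℕ} (T : RTree m) {x y z : T.V} {a b : ℕ}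
    (hy : T.parent^[a] x = y) (hz : T.parent^[b] x = z) :
    (∃ k : ℕ, T.parent^[k] y = z) ∨ ∃ k : ℕ, T.parent^[k] z = y := by
  rcases le_total a b with h | h
  · obtain ⟨d, rfl⟩ := Nat.exists_eq_add_of_le h
    exact Or.inl ⟨d, by rw [← hz, ← hy, ← Function.iterate_add_apply, add_comm]⟩
  · obtain ⟨d, rfl⟩ := Nat.exists_eq_add_of_le h
    exact Or.inr ⟨d, by rw [← hz, ← hy, ← Function.iterate_add_apply, add_comm]⟩

/-- Siblings are not ancestors of one another. -/
theorem RTree.eq_of_ancestor_of_parent_eq {m : ℕ} (T : RTree m) {c d v : T.V} {k : ℕ}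
    (hc : T.parent c = v) (hd : T.parent d = v) (hdv : d ≠ v)
    (h : T.parent^[k] c = d) : c = d := by
  cases k with
  | zero => exact h
  | succ k =>
    rw [Function.iterate_succ_apply, hc] at h
    exact absurd (T.ancestor_antisymm (a := 1) hd h) hdv

theorem RTree.eq_of_lset_eq_of_ancestor {m : ℕ} (T : RTree m) (hT : T.TwoChildren)
    {x y : T.V} (h : T.lset x = T.lset y) {k : ℕ} (hk : T.parent^[k] x = y) : x = y := by
  induction k with
  | zero => exact hk
  | succ k ih =>
    by_cases hxk : T.parent^[k] x = y
    · exact ih hxk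
    rw [Function.iterate_succ_apply'] at hk
    obtain ⟨d, hdy, hdc, hd⟩ : ∃ d, d ≠ y ∧ d ≠ T.parent^[k] x ∧ T.parent d = y := by
      obtain ⟨u, u', hu, hu', hne, hpu, hpu'⟩ := hT y ⟨_, hxk, hk⟩
      by_cases hux : u = T.parent^[k] x
      · exact ⟨u', hu', fun h' => hne (hux.trans h'.symm), hpu'⟩
      · exact ⟨u, hu, hux, hpu⟩
    obtain ⟨j, a, ha⟩ := T.lset_nonempty d
    obtain ⟨b, hb⟩ : j ∈ T.lset x := by
      rw [h]
      exact ⟨a + 1, by rw [Function.iterate_succ_apply', ha, hd]⟩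
    have hb' : T.parent^[k + b] (T.leaf j) = T.parent^[k] x := by
      rw [Function.iterate_add_apply, hb]
    rcases T.ancestor_total ha hb' with ⟨l, hl⟩ | ⟨l, hl⟩
    · exact absurd (T.eq_of_ancestor_of_parent_eq hd hk hxk hl) hdc
    · exact absurd (T.eq_of_ancestor_of_parent_eq hk hd hdy hl).symm hdc

theorem RTree.lset_injective {m : ℕ} (T : RTree m) (hT : T.TwoChildren) :
    Function.Injective T.lset := by
  intro x y h
  obtain ⟨i, a, ha⟩ := T.lset_nonempty x
  obtain ⟨b, hb⟩ : i ∈ T.lset y := h ▸ ⟨a, ha⟩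
  rcases T.ancestor_total ha hb with ⟨k, hk⟩ | ⟨k, hk⟩
  · exact T.eq_of_lset_eq_of_ancestor hT h hk
  · exact (T.eq_of_lset_eq_of_ancestor hT h.symm hk).symm

open scoped Classical in
theorem finsum_mem_setOf_eq_sum_ite {α M : Type*} [Fintype α] [AddCommMonoid M] (P : α → Prop)
    (f : α → M) : ∑ᶠ a ∈ {a | P a}, f a = ∑ a, if P a then f a else 0 := by
  rw [finsum_mem_def, finsum_eq_sum_of_fintype]
  simp only [Set.indicator_apply, Set.mem_ofPred_eq]

open scoped Classical in
theorem ncard_support_eq_sum_ite {α M : Type*} [Fintype α] [Zero M] (f : α → M) :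
    (Function.support f).ncard = ∑ a, if f a ≠ 0 then 1 else 0 := by
  have : Function.support f = ↑(Finset.univ.filter fun a => f a ≠ 0) := by
    ext a
    simp
  rw [this, Set.ncard_coe_finset, Finset.sum_boole, Nat.cast_id]

/-- A sum over `β × γ` of a function vanishing when the second component is outside the range of
an injection `L` is a double sum over the source of `L` and `β`. -/
theorem sum_prod_eq_sum_of_injective {ι β γ M : Type*} [Fintype ι] [Fintype β] [Fintype γ]
    [AddCommMonoid M] {L : ι → γ} (hL : Function.Injective L) (g : β × γ → M)
    (hg : ∀ p, p.2 ∉ Set.range L → g p = 0) : ∑ p, g p = ∑ v, ∑ s, g (s, L v) := by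
  rw [Fintype.sum_prod_type_right]
  exact (Fintype.sum_of_injective L hL _ _
    (fun t ht => Finset.sum_eq_zero fun s _ => hg (s, t) ht) fun _ => rfl).symm

open scoped Classical in
theorem colVec_apply {m n : ℕ} (T2 : RTree n) (w : Set (Fin m) × Set (Fin n) → ℝ) (v : T2.V)
    (i : Fin m) : colVec T2 w v i = ∑ s, if i ∈ s then w (s, T2.lset v) else 0 := by
  rw [colVec, finsum_mem_setOf_eq_sum_ite, Fintype.sum_prod_type]
  refine Finset.sum_congr rfl fun s _ => ?_
  by_cases hi : i ∈ s <;> simp [hi]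

section Combine

variable {m n : ℕ} {T1 : RTree m} {T2 : RTree n}

theorem combine_lset (hT2 : T2.TwoChildren) (w1 : T2.V → Set (Fin m) → ℝ) (s : Set (Fin m))
    (v : T2.V) : combine T2 w1 (s, T2.lset v) = w1 v s := by
  have : {u : T2.V | T2.lset u = T2.lset v} = {v} := by
    ext u
    exact (T2.lset_injective hT2).eq_iff
  simp only [combine, this, finsum_mem_singleton]

theorem combine_eq_zero (w1 : T2.V → Set (Fin m) → ℝ) (p : Set (Fin m) × Set (Fin n))
    (hp : p.2 ∉ Set.range T2.lset) : combine T2 w1 p = 0 := by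
  have : {u : T2.V | T2.lset u = p.2} = ∅ := by
    ext u
    exact iff_of_false (fun h => hp ⟨u, h⟩) id
  simp only [combine, this, finsum_mem_empty]

theorem colVec_combine (hT2 : T2.TwoChildren) {w1 : T2.V → Set (Fin m) → ℝ}
    {v : T2.V} {V0 : Fin m → ℝ} (h : Sol1 T1 V0 (w1 v)) :
    colVec T2 (combine T2 w1) v = V0 := by
  classical
  funext i
  rw [colVec_apply, ← h.2.2 i, finsum_mem_setOf_eq_sum_ite]
  simp only [combine_lset hT2]

/-- The matrix entries represented by `w` are determined by the vectors `colVec T2 w v`. -/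
theorem finsum_mem_eq_sum_colVec (hT2 : T2.TwoChildren) {w : Set (Fin m) × Set (Fin n) → ℝ}
    (hw : ∀ p, p.2 ∉ Set.range T2.lset → w p = 0) (i : Fin m) (j : Fin n) :
    ∑ᶠ p ∈ {p : Set (Fin m) × Set (Fin n) | i ∈ p.1 ∧ j ∈ p.2}, w p =
      ∑ᶠ v ∈ {v : T2.V | j ∈ T2.lset v}, colVec T2 w v i := by
  classical
  rw [finsum_mem_setOf_eq_sum_ite, finsum_mem_setOf_eq_sum_ite,
    sum_prod_eq_sum_of_injective (T2.lset_injective hT2) _ fun p hp => by simp [hw p hp]]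
  refine Finset.sum_congr rfl fun v _ => ?_
  by_cases hj : j ∈ T2.lset v <;> simp [hj, colVec_apply]

theorem ncard_support_eq_sum (hT2 : T2.TwoChildren) {w : Set (Fin m) × Set (Fin n) → ℝ}
    (hw : ∀ p, p.2 ∉ Set.range T2.lset → w p = 0) :
    (Function.support w).ncard =
      ∑ v : T2.V, (Function.support fun s => w (s, T2.lset v)).ncard := by
  classical
  rw [ncard_support_eq_sum_ite,
    sum_prod_eq_sum_of_injective (T2.lset_injective hT2) _ fun p hp => by simp [hw p hp]]
  simp only [ncard_support_eq_sum_ite]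

theorem Sol2.eq_zero {A : Fin m → Fin n → ℝ} {w : Set (Fin m) × Set (Fin n) → ℝ}
    (hw : Sol2 T1 T2 A w) (p : Set (Fin m) × Set (Fin n)) (hp : p.2 ∉ Set.range T2.lset) :
    w p = 0 := by
  by_contra h
  obtain ⟨u, v, rfl⟩ := hw.2.1 p h
  exact hp ⟨v, rfl⟩

theorem Sol2.sol1_colVec {A : Fin m → Fin n → ℝ}
    {w : Set (Fin m) × Set (Fin n) → ℝ} (hw : Sol2 T1 T2 A w) (v : T2.V) :
    Sol1 T1 (colVec T2 w v) fun s => w (s, T2.lset v) := by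
  classical
  refine ⟨Set.toFinite _, fun s hs => ?_, fun i => ?_⟩
  · obtain ⟨u, v', h⟩ := hw.2.1 _ hs
    exact ⟨u, congrArg Prod.fst h⟩
  · rw [colVec_apply, finsum_mem_setOf_eq_sum_ite]

/-- Replacing each row part of a solution by another solution for the same vector gives a
solution for the same matrix. -/
theorem Sol2.combine (hT2 : T2.TwoChildren) {A : Fin m → Fin n → ℝ}
    {w : Set (Fin m) × Set (Fin n) → ℝ} (hw : Sol2 T1 T2 A w)
    {w1 : T2.V → Set (Fin m) → ℝ} (h1 : ∀ v, Sol1 T1 (colVec T2 w v) (w1 v)) :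
    Sol2 T1 T2 A (combine T2 w1) := by
  classical
  refine ⟨Set.toFinite _, fun p hp => ?_, fun i j => ?_⟩
  · obtain ⟨s, t⟩ := p
    by_cases ht : t ∈ Set.range T2.lset
    · obtain ⟨v, rfl⟩ := ht
      rw [combine_lset hT2] at hp
      obtain ⟨u, rfl⟩ := (h1 v).2.1 s hp
      exact ⟨u, v, rfl⟩
    · exact absurd (combine_eq_zero w1 _ ht) hp
  · rw [← hw.2.2 i j, finsum_mem_eq_sum_colVec hT2 (combine_eq_zero w1),
      finsum_mem_eq_sum_colVec hT2 hw.eq_zero]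
    simp only [colVec_combine hT2 (h1 _)]

theorem ncard_support_combine (hT2 : T2.TwoChildren) (w1 : T2.V → Set (Fin m) → ℝ) :
    (Function.support (combine T2 w1)).ncard = ∑ v, (Function.support (w1 v)).ncard := by
  rw [ncard_support_eq_sum hT2 (combine_eq_zero w1)]
  simp only [combine_lset hT2]

end Combine

/-- for any optimal solution `w` for `A`, `∑_v OPT₁(V_v) = OPT₂(A)`, and
the union over nodes `v` of an optimal 1-d solution for `V_v` crossed with `S²_v` is
again an optimal solution for `A`. -/
theorem stmt4 {m n : ℕ} (A : Fin m → Fin n → ℝ) (T1 : RTree m) (T2 : RTree n)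
    (hT2 : T2.TwoChildren)
    (w : Set (Fin m) × Set (Fin n) → ℝ) (hw : Sol2 T1 T2 A w)
    (hopt : (Function.support w).ncard = Opt2 T1 T2 A) :
    (∑ᶠ v : T2.V, Opt1 T1 (colVec T2 w v)) = Opt2 T1 T2 A ∧
    ∀ w1 : T2.V → (Set (Fin m) → ℝ),
      (∀ v : T2.V, Sol1 T1 (colVec T2 w v) (w1 v) ∧
        (Function.support (w1 v)).ncard = Opt1 T1 (colVec T2 w v)) →
      Sol2 T1 T2 A (combine T2 w1) ∧
      (Function.support (combine T2 w1)).ncard = Opt2 T1 T2 A := by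
  have hle : ∑ v, Opt1 T1 (colVec T2 w v) ≤ Opt2 T1 T2 A := by
    rw [← hopt, ncard_support_eq_sum hT2 hw.eq_zero]
    exact Finset.sum_le_sum fun v _ => Nat.sInf_le ⟨_, hw.sol1_colVec v, rfl⟩
  have hcard : ∀ w1 : T2.V → (Set (Fin m) → ℝ),
      (∀ v : T2.V, Sol1 T1 (colVec T2 w v) (w1 v) ∧
        (Function.support (w1 v)).ncard = Opt1 T1 (colVec T2 w v)) →
      (Function.support (combine T2 w1)).ncard = ∑ v, Opt1 T1 (colVec T2 w v) := fun w1 h1 => by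
    rw [ncard_support_combine hT2, Finset.sum_congr rfl fun v _ => (h1 v).2]
  have hge : ∀ w1 : T2.V → (Set (Fin m) → ℝ),
      (∀ v : T2.V, Sol1 T1 (colVec T2 w v) (w1 v) ∧
        (Function.support (w1 v)).ncard = Opt1 T1 (colVec T2 w v)) →
      Opt2 T1 T2 A ≤ ∑ v, Opt1 T1 (colVec T2 w v) := fun w1 h1 =>
    Nat.sInf_le ⟨_, hw.combine hT2 fun v => (h1 v).1, hcard w1 h1⟩
  refine ⟨?_, fun w1 h1 => ⟨hw.combine hT2 fun v => (h1 v).1,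
    (hcard w1 h1).trans (hle.antisymm (hge w1 h1))⟩⟩
  have hex : ∀ v : T2.V, ∃ f : Set (Fin m) → ℝ, Sol1 T1 (colVec T2 w v) f ∧
      (Function.support f).ncard = Opt1 T1 (colVec T2 w v) := fun v =>
    Nat.sInf_mem (s := {k : ℕ | ∃ f : Set (Fin m) → ℝ, Sol1 T1 (colVec T2 w v) f ∧
      (Function.support f).ncard = k}) ⟨_, _, hw.sol1_colVec v, rfl⟩
  choose w1 h1 using hex
  rw [finsum_eq_sum_of_fintype]
  exact hle.antisymm (hge w1 h1)
end

section
/- If there exists an interval solution for (a_k) of size K, then there exists a partition of {0,1,…,n} into M parts, each part P satisfying Σ_{k ∈ P} Δ_k = 0, with M ≥ n + 1 − K. Equivalently, every interval solution has size at least (n+1) − M*, where M* is the maximum number of parts in a partition of {0,…,n} into sets each of whose Δ-values sum to zero. -/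
/-- `a` padded with zeros: `a₀ = a_{n+1} = 0` (and beyond). -/
def pad (n : ℕ) (a : ℕ → ℝ) : ℕ → ℝ := fun k => if 1 ≤ k ∧ k ≤ n then a k else 0

/-- `Δ_k = a_{k+1} - a_k` (with the zero-padding convention). -/
def Dlt (n : ℕ) (a : ℕ → ℝ) (k : ℕ) : ℝ := pad n a (k + 1) - pad n a k

/-- An interval solution for `a₁,…,a_n`: weights on the intervals `[i,j]`,
`1 ≤ i ≤ j ≤ n`, such that for each `k ∈ {1,…,n}` the weights of the intervals
containing `k` sum to `a_k`. -/
def IsIntSol (n : ℕ) (a : ℕ → ℝ) (w : ℕ → ℕ → ℝ) : Prop :=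
  (∀ i j : ℕ, ¬(1 ≤ i ∧ i ≤ j ∧ j ≤ n) → w i j = 0) ∧
  (∀ k ∈ Finset.Icc 1 n, ∑ i ∈ Finset.Icc 1 k, ∑ j ∈ Finset.Icc k n, w i j = a k)

/-- The size of an interval solution: the number of intervals with nonzero weight. -/
noncomputable def intSize (w : ℕ → ℕ → ℝ) : ℕ := {p : ℕ × ℕ | w p.1 p.2 ≠ 0}.ncard

/-- A graph with edge set `E` on the vertex set `V` has at least `#V - #E` components: there is a
colouring constant along every edge that uses at least that many colours on `V`. -/
theorem exists_coloring_constant_on_edges {α : Type*} [DecidableEq α] (V : Finset α)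
    (E : Finset (α × α)) :
    ∃ f : α → α, (∀ p ∈ E, f p.1 = f p.2) ∧ V.card ≤ (V.image f).card + E.card := by
  induction E using Finset.induction_on with
  | empty => exact ⟨id, by simp⟩
  | insert e E he ih =>
    obtain ⟨f, hf, hcard⟩ := ih
    refine ⟨fun x => if f x = f e.2 then f e.1 else f x, ?_, ?_⟩
    · intro p hp
      rcases Finset.mem_insert.1 hp with rfl | hp
      · simp
      · simp only [hf p hp]
    · have hsub : (V.image f).erase (f e.2) ⊆
          V.image fun x => if f x = f e.2 then f e.1 else f x := by
        intro c hc
        obtain ⟨hne, hc⟩ := Finset.mem_erase.1 hc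
        obtain ⟨x, hx, rfl⟩ := Finset.mem_image.1 hc
        exact Finset.mem_image.2 ⟨x, hx, if_neg hne⟩
      have hle := Finset.card_le_card hsub
      have hpred := Finset.pred_card_le_card_erase (s := V.image f) (a := f e.2)
      rw [Finset.card_insert_of_notMem he]
      omega

theorem IsIntSol.pad_eq_sum {n : ℕ} {a : ℕ → ℝ} {w : ℕ → ℕ → ℝ} (h : IsIntSol n a w) (k : ℕ) :
    pad n a k = ∑ p ∈ Finset.Icc 1 n ×ˢ Finset.Icc 1 n,
      if p.1 ≤ k ∧ k ≤ p.2 then w p.1 p.2 else 0 := by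
  unfold pad
  split_ifs with hk
  · rw [← h.2 k (Finset.mem_Icc.2 hk), ← Finset.sum_product', ← Finset.sum_filter]
    refine Finset.sum_congr ?_ fun _ _ => rfl
    ext p
    simp only [Finset.mem_product, Finset.mem_Icc, Finset.mem_filter]
    omega
  · refine (Finset.sum_eq_zero fun p hp => if_neg ?_).symm
    simp only [Finset.mem_product, Finset.mem_Icc] at hp
    omega

theorem IsIntSol.Dlt_eq_sum {n : ℕ} {a : ℕ → ℝ} {w : ℕ → ℕ → ℝ} (h : IsIntSol n a w) (k : ℕ) :
    Dlt n a k = ∑ p ∈ Finset.Icc 1 n ×ˢ Finset.Icc 1 n,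
      ((if p.1 - 1 = k then w p.1 p.2 else 0) - if p.2 = k then w p.1 p.2 else 0) := by
  rw [Dlt, h.pad_eq_sum, h.pad_eq_sum, ← Finset.sum_sub_distrib]
  refine Finset.sum_congr rfl fun p _ => ?_
  by_cases hp : 1 ≤ p.1 ∧ p.1 ≤ p.2 ∧ p.2 ≤ n
  · split_ifs <;> first | omega | simp
  · simp [h.1 _ _ hp]

theorem IsIntSol.sum_Dlt_eq_zero {n : ℕ} {a : ℕ → ℝ} {w : ℕ → ℕ → ℝ} (h : IsIntSol n a w)
    {S : Finset ℕ} (hS : ∀ i j, w i j ≠ 0 → (i - 1 ∈ S ↔ j ∈ S)) :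
    ∑ k ∈ S, Dlt n a k = 0 := by
  simp only [h.Dlt_eq_sum]
  rw [Finset.sum_comm]
  refine Finset.sum_eq_zero fun p _ => ?_
  rw [Finset.sum_sub_distrib, Finset.sum_ite_eq, Finset.sum_ite_eq]
  by_cases hw : w p.1 p.2 = 0
  · simp [hw]
  · simp [hS _ _ hw]

theorem IsIntSol.finite_support {n : ℕ} {a : ℕ → ℝ} {w : ℕ → ℕ → ℝ} (h : IsIntSol n a w) :
    {p : ℕ × ℕ | w p.1 p.2 ≠ 0}.Finite := by
  refine (Finset.Icc 1 n ×ˢ Finset.Icc 1 n).finite_toSet.subset fun p hp => ?_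
  have := not_imp_comm.1 (h.1 p.1 p.2) hp
  simp only [Finset.coe_product, Set.mem_prod, Finset.coe_Icc, Set.mem_Icc]
  omega

/-- from an interval solution of size `K` one gets a partition of
`{0,…,n}` into `M ≥ n + 1 - K` parts, each of whose `Δ`-values sum to zero. -/
theorem stmt8 (n : ℕ) (hn : 1 ≤ n) (a : ℕ → ℝ) (w : ℕ → ℕ → ℝ)
    (hsol : IsIntSol n a w) :
    ∃ P : Finset (Finset ℕ),
      (∀ S ∈ P, S.Nonempty) ∧
      (P : Set (Finset ℕ)).PairwiseDisjoint id ∧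
      P.sup id = Finset.Icc 0 n ∧
      (∀ S ∈ P, ∑ k ∈ S, Dlt n a k = 0) ∧
      n + 1 ≤ P.card + intSize w := by
  classical
  set E := hsol.finite_support.toFinset with hE
  obtain ⟨f, hf, hcard⟩ := exists_coloring_constant_on_edges (Finset.Icc 0 n)
    (E.image fun p => (p.1 - 1, p.2))
  have hEcard : E.card = intSize w := (Set.ncard_eq_toFinset_card _ hsol.finite_support).symm
  have hle : (E.image fun p => (p.1 - 1, p.2)).card ≤ E.card := Finset.card_image_le
  have hedge : ∀ i j, w i j ≠ 0 → f (i - 1) = f j := fun i j hw =>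
    hf (i - 1, j) (Finset.mem_image.2 ⟨(i, j), by simpa [hE] using hw, rfl⟩)
  refine ⟨((Finset.Icc 0 n).image f).image fun c => (Finset.Icc 0 n).filter (f · = c),
    ?_, ?_, ?_, ?_, ?_⟩
  · simp only [Finset.forall_mem_image]
    exact fun x hx => ⟨x, Finset.mem_filter.2 ⟨hx, rfl⟩⟩
  · intro S hS T hT hne
    obtain ⟨c, -, rfl⟩ := Finset.mem_image.1 hS
    obtain ⟨d, -, rfl⟩ := Finset.mem_image.1 hT
    refine Finset.disjoint_left.2 fun x hx hy => hne ?_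
    rw [← (Finset.mem_filter.1 hx).2, ← (Finset.mem_filter.1 hy).2]
  · ext x
    simp only [Finset.mem_sup, Finset.exists_mem_image, id, Finset.mem_filter]
    exact ⟨fun ⟨_, _, hx, _⟩ => hx, fun hx => ⟨x, hx, hx, rfl⟩⟩
  · simp only [Finset.forall_mem_image]
    refine fun x _ => hsol.sum_Dlt_eq_zero fun i j hw => ?_
    have hij := not_imp_comm.1 (hsol.1 i j) hw
    simp only [Finset.mem_filter, Finset.mem_Icc, hedge i j hw]
    exact and_congr_left fun _ => by omega
  · rw [Finset.card_image_of_injOn, ← hEcard]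
    · rw [Nat.card_Icc] at hcard
      omega
    · intro c hc d _ hcd
      obtain ⟨x, hx, rfl⟩ := Finset.mem_image.1 hc
      have hmem : x ∈ (Finset.Icc 0 n).filter (f · = f x) := Finset.mem_filter.2 ⟨hx, rfl⟩
      exact (Finset.mem_filter.1 ((Finset.ext_iff.1 hcd x).1 hmem)).2
end

section
/- Given any partition of {0,1,…,n} into M parts S_1,…,S_M, each satisfying Σ_{k ∈ S_t} Δ_k = 0, there exists an interval solution for (a_k) of size at most n + 1 − M; explicitly, letting k_t = min S_t, assigning weight −Δ_k to the interval [k_t + 1, k] for each k ∈ S_t \ {k_t} (and weight 0 to all other intervals) yields an interval solution. -/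
/-- The differences `Δ_k, …, Δ_n` telescope to `-a_k`. -/
lemma sum_Dlt_Icc (n : ℕ) (a : ℕ → ℝ) {k : ℕ} (hk : k ∈ Finset.Icc 1 n) :
    ∑ j ∈ Finset.Icc k n, Dlt n a j = -a k := by
  obtain ⟨h1, h2⟩ := Finset.mem_Icc.1 hk
  rw [← Finset.Ico_add_one_right_eq_Icc]
  simp only [Dlt]
  rw [Finset.sum_Ico_sub (pad n a) (by omega)]
  simp [pad, h1, h2]

/-- The total weight that a single zero-sum part `S` with minimum `m` puts on the intervals
containing `k`. -/
lemma sum_part_weight (n k m : ℕ) (S : Finset ℕ) (d : ℕ → ℝ) (hS : S ⊆ Finset.Icc 0 n)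
    (hzero : ∑ j ∈ S, d j = 0) (hm : ∀ x ∈ S, m ≤ x) :
    ∑ i ∈ Finset.Icc 1 k, ∑ j ∈ Finset.Icc k n,
        (if j ∈ S ∧ j ≠ m ∧ i = m + 1 then -(d j) else 0)
      = -∑ j ∈ Finset.Icc k n, if j ∈ S then d j else 0 := by
  rw [Finset.sum_comm]
  by_cases hmk : m < k
  · rw [← Finset.sum_neg_distrib]
    refine Finset.sum_congr rfl fun j hj => ?_
    have hjm : j ≠ m := by have := (Finset.mem_Icc.1 hj).1; omega
    have hmem : m + 1 ∈ Finset.Icc 1 k := Finset.mem_Icc.2 (by omega)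
    by_cases hjS : j ∈ S
    · simp only [hjS, hjm, ne_eq, not_false_eq_true, true_and, if_true]
      rw [Finset.sum_ite_eq', if_pos hmem]
    · simp [hjS]
  · have hsub : S ⊆ Finset.Icc k n := fun x hx => by
      have h1 := hm x hx
      have h2 := (Finset.mem_Icc.1 (hS hx)).2
      exact Finset.mem_Icc.2 (by omega)
    rw [← Finset.sum_filter, Finset.filter_mem_eq_inter, Finset.inter_eq_right.2 hsub, hzero,
      neg_zero]
    refine Finset.sum_eq_zero fun j _ => Finset.sum_eq_zero fun i hi => if_neg ?_
    rintro ⟨-, -, rfl⟩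
    have := (Finset.mem_Icc.1 hi).2
    omega

/-- Summing the restrictions of `d` to disjoint parts covering `j` recovers `d j`. -/
lemma sum_ite_mem_part {ι : Type*} [Fintype ι] (S : ι → Finset ℕ)
    (hdisj : ∀ t t' : ι, t ≠ t' → Disjoint (S t) (S t')) (d : ℕ → ℝ) {j : ℕ}
    (hj : ∃ t, j ∈ S t) : ∑ t, (if j ∈ S t then d j else 0) = d j := by
  obtain ⟨t, ht⟩ := hj
  rw [Finset.sum_eq_single t, if_pos ht]
  · exact fun b _ hb => if_neg fun hbj => Finset.disjoint_left.1 (hdisj b t hb) hbj ht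
  · simp

/-- from a partition `S₁,…,S_M` of `{0,…,n}` into zero-`Δ`-sum parts,
assigning weight `-Δ_k` to the interval `[k_t + 1, k]` for each `k ∈ S_t \ {k_t}`
(where `k_t = min S_t`) yields an interval solution of size at most `n + 1 - M`. -/
theorem stmt9 (n : ℕ) (hn : 1 ≤ n) (a : ℕ → ℝ) (M : ℕ)
    (S : Fin M → Finset ℕ) (kt : Fin M → ℕ)
    (hdisj : ∀ t t' : Fin M, t ≠ t' → Disjoint (S t) (S t'))
    (hcover : Finset.univ.biUnion S = Finset.Icc 0 n)
    (hzero : ∀ t : Fin M, ∑ k ∈ S t, Dlt n a k = 0)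
    (hkt : ∀ t : Fin M, kt t ∈ S t ∧ ∀ x ∈ S t, kt t ≤ x) :
    IsIntSol n a
      (fun i j => ∑ t : Fin M,
        if j ∈ S t ∧ j ≠ kt t ∧ i = kt t + 1 then -(Dlt n a j) else 0) ∧
    intSize
      (fun i j => ∑ t : Fin M,
        if j ∈ S t ∧ j ≠ kt t ∧ i = kt t + 1 then -(Dlt n a j) else 0) + M ≤ n + 1 := by
  have hsub : ∀ t, S t ⊆ Finset.Icc 0 n := fun t =>
    hcover ▸ Finset.subset_biUnion_of_mem S (Finset.mem_univ t)
  refine ⟨⟨fun i j hij => ?_, fun k hk => ?_⟩, ?_⟩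
  · refine Finset.sum_eq_zero fun t _ => if_neg ?_
    rintro ⟨hj, hne, rfl⟩
    have h1 := (hkt t).2 j hj
    have h2 := (Finset.mem_Icc.1 (hsub t hj)).2
    omega
  · calc
      _ = ∑ t, ∑ i ∈ Finset.Icc 1 k, ∑ j ∈ Finset.Icc k n,
            (if j ∈ S t ∧ j ≠ kt t ∧ i = kt t + 1 then -(Dlt n a j) else 0) := by
          symm
          rw [Finset.sum_comm]
          exact Finset.sum_congr rfl fun i _ => Finset.sum_comm
      _ = ∑ t, -∑ j ∈ Finset.Icc k n, (if j ∈ S t then Dlt n a j else 0) :=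
          Finset.sum_congr rfl fun t _ =>
            sum_part_weight n k (kt t) (S t) _ (hsub t) (hzero t) (hkt t).2
      _ = -∑ j ∈ Finset.Icc k n, ∑ t, (if j ∈ S t then Dlt n a j else 0) := by
          rw [Finset.sum_neg_distrib, Finset.sum_comm]
      _ = -∑ j ∈ Finset.Icc k n, Dlt n a j := by
          refine congrArg _ (Finset.sum_congr rfl fun j hj => ?_)
          have hj' : j ∈ Finset.univ.biUnion S := by
            rw [hcover]
            exact Finset.mem_Icc.2 ⟨j.zero_le, (Finset.mem_Icc.1 hj).2⟩
          exact sum_ite_mem_part S hdisj _ (by simpa using hj')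
      _ = a k := by rw [sum_Dlt_Icc n a hk, neg_neg]
  · have hcard : ∑ t, (S t).card = n + 1 := by
      rw [← Finset.card_biUnion fun t _ t' _ h => hdisj t t' h, hcover]
      simp
    have hsupp : {p : ℕ × ℕ | (∑ t : Fin M,
        if p.2 ∈ S t ∧ p.2 ≠ kt t ∧ p.1 = kt t + 1 then -(Dlt n a p.2) else 0) ≠ 0} ⊆
        ↑(Finset.univ.biUnion fun t =>
          ((S t).erase (kt t)).image fun j => (kt t + 1, j)) := by
      rintro ⟨i, j⟩ hp
      obtain ⟨t, -, ht⟩ := Finset.exists_ne_zero_of_sum_ne_zero hp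
      obtain ⟨hj, hne, hi⟩ := (ite_ne_right_iff.1 ht).1
      simp only [Finset.coe_biUnion, Set.mem_iUnion]
      exact ⟨t, by simp, Finset.mem_coe.2 <|
        Finset.mem_image.2 ⟨j, Finset.mem_erase.2 ⟨hne, hj⟩, Prod.ext hi.symm rfl⟩⟩
    calc
      _ ≤ ∑ t, ((S t).erase (kt t)).card + M := by
          refine Nat.add_le_add_right ?_ M
          refine (Set.ncard_le_ncard hsupp (Finset.finite_toSet _)).trans ?_
          rw [Set.ncard_coe_finset]
          exact Finset.card_biUnion_le.trans
            (Finset.sum_le_sum fun t _ => Finset.card_image_le)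
      _ = ∑ t, (((S t).erase (kt t)).card + 1) := by simp [Finset.sum_add_distrib]
      _ = ∑ t, (S t).card :=
          Finset.sum_congr rfl fun t _ => Finset.card_erase_add_one (hkt t).1
      _ ≤ n + 1 := hcard.le
end

section
/- In the instance consisting of the 3m item values b_1,…,b_{3m} together with m slack values each equal to −B: every nonempty subset of the 4m indices whose values sum to 0 contains at least 4 indices; moreover, every 4-element subset whose values sum to 0 contains exactly one slack index and three item indices k_1, k_2, k_3 with b_{k_1} + b_{k_2} + b_{k_3} = B. -/
/-- If item values lie in `(B/4, B/2)` and slack values are `-B`, a nonempty zero-sum set with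
`p` items and `q` slacks satisfies `2 * q < p < 4 * q`, and its items sum to `q * B`. -/
lemma zero_sum_item_slack_bounds {α β : Type*} {B : ℝ} (hB : 0 < B) {b : α → ℝ}
    (hb : ∀ k, B / 4 < b k ∧ b k < B / 2) {S : Finset (α ⊕ β)} (hS : S.Nonempty)
    (h : ∑ x ∈ S, Sum.elim b (fun _ => -B) x = 0) :
    2 * S.toRight.card < S.toLeft.card ∧ S.toLeft.card < 4 * S.toRight.card ∧
      ∑ k ∈ S.toLeft, b k = S.toRight.card * B := by
  have hsum : ∑ k ∈ S.toLeft, b k = S.toRight.card * B := by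
    rw [← S.toLeft_disjSum_toRight, Finset.sum_disjSum] at h
    simp only [Sum.elim_inl, Sum.elim_inr, Finset.sum_const, nsmul_eq_mul] at h
    linarith
  have hne : S.toLeft.Nonempty := by
    by_contra hempty
    rw [Finset.not_nonempty_iff_eq_empty] at hempty
    rw [hempty, Finset.sum_empty, eq_comm, mul_eq_zero, Nat.cast_eq_zero] at hsum
    have hright := hsum.resolve_right hB.ne'
    have hcard := S.card_toLeft_add_card_toRight
    rw [hempty, hright, Finset.card_empty] at hcard
    have := hS.card_pos
    omega
  have hlower := Finset.sum_lt_sum_of_nonempty hne fun k _ => (hb k).1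
  have hupper := Finset.sum_lt_sum_of_nonempty hne fun k _ => (hb k).2
  rw [hsum, Finset.sum_const, nsmul_eq_mul] at hlower hupper
  refine ⟨?_, ?_, hsum⟩
  · have : (2 * S.toRight.card : ℝ) < S.toLeft.card := by
      refine lt_of_mul_lt_mul_right ?_ hB.le
      linarith
    exact_mod_cast this
  · have : (S.toLeft.card : ℝ) < 4 * S.toRight.card := by
      refine lt_of_mul_lt_mul_right ?_ hB.le
      linarith
    exact_mod_cast this

/-- in the instance with item values `b₁,…,b_{3m}` (each in `(B/4, B/2)`)
and `m` slack values `-B`: every nonempty zero-sum subset of the `4m` indices has at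
least `4` elements, and every `4`-element zero-sum subset consists of exactly one slack
index and three item indices whose values sum to `B`. -/
theorem stmt11 (m : ℕ) (hm : 1 ≤ m) (B : ℝ) (hB : 0 < B)
    (b : Fin (3 * m) → ℝ) (hb : ∀ k, B / 4 < b k ∧ b k < B / 2) :
    (∀ S : Finset (Fin (3 * m) ⊕ Fin m), S.Nonempty →
      ∑ x ∈ S, Sum.elim b (fun _ => -B) x = 0 → 4 ≤ S.card) ∧
    (∀ S : Finset (Fin (3 * m) ⊕ Fin m), S.card = 4 →
      ∑ x ∈ S, Sum.elim b (fun _ => -B) x = 0 →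
      ∃ (s : Fin m) (k₁ k₂ k₃ : Fin (3 * m)),
        k₁ ≠ k₂ ∧ k₁ ≠ k₃ ∧ k₂ ≠ k₃ ∧
        S = {Sum.inl k₁, Sum.inl k₂, Sum.inl k₃, Sum.inr s} ∧
        b k₁ + b k₂ + b k₃ = B) := by
  refine ⟨fun S hS h => ?_, fun S hcard h => ?_⟩
  · obtain ⟨hlower, hupper, -⟩ := zero_sum_item_slack_bounds hB hb hS h
    have := S.card_toLeft_add_card_toRight
    omega
  · have hS : S.Nonempty := Finset.card_pos.mp (by omega)
    obtain ⟨hlower, hupper, hsum⟩ := zero_sum_item_slack_bounds hB hb hS h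
    have htotal := S.card_toLeft_add_card_toRight
    have hright : S.toRight.card = 1 := by omega
    have hleft : S.toLeft.card = 3 := by omega
    obtain ⟨s, hs⟩ := Finset.card_eq_one.mp hright
    obtain ⟨k₁, k₂, k₃, h₁₂, h₁₃, h₂₃, hk⟩ := Finset.card_eq_three.mp hleft
    refine ⟨s, k₁, k₂, k₃, h₁₂, h₁₃, h₂₃, ?_, ?_⟩
    · rw [← S.toLeft_disjSum_toRight, hk, hs]
      ext x
      cases x <;> simp
    · rw [hright, hk, Finset.sum_insert (by simp [h₁₂, h₁₃]), Finset.sum_pair h₂₃] at hsum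
      push_cast at hsum
      linarith
end

section
/- The set of 4m indices can be partitioned into m subsets, each of whose values sum to 0, if and only if {1,…,3m} can be partitioned into m triples {k_1,k_2,k_3} with b_{k_1} + b_{k_2} + b_{k_3} = B (i.e., if and only if the instance of 3-Partition is a yes-instance). In that case each part of the zero-sum partition has exactly 4 elements, namely one slack index and one triple. -/
open Finset in
/-- A set of reals in `(B / 4, B / 2)` that sums to `B` has exactly three elements. -/
theorem card_eq_three_of_sum_eq {ι : Type*} {B : ℝ} (hB : 0 < B) {b : ι → ℝ}
    (hb : ∀ k, B / 4 < b k ∧ b k < B / 2) {s : Finset ι} (hs : ∑ k ∈ s, b k = B) :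
    s.card = 3 := by
  have hne : s.Nonempty := by
    rw [nonempty_iff_ne_empty]
    rintro rfl
    simp only [sum_empty] at hs
    exact hB.ne hs
  have hlow : ∑ _k ∈ s, B / 4 < ∑ k ∈ s, b k := sum_lt_sum_of_nonempty hne fun k _ => (hb k).1
  have hupp : ∑ k ∈ s, b k < ∑ _k ∈ s, B / 2 := sum_lt_sum_of_nonempty hne fun k _ => (hb k).2
  rw [sum_const, nsmul_eq_mul, hs] at hlow hupp
  have hlt : (s.card : ℝ) < 4 := by
    by_contra! h
    nlinarith
  have hgt : (2 : ℝ) < s.card := by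
    by_contra! h
    nlinarith
  have : s.card < 4 := by exact_mod_cast hlt
  have : 2 < s.card := by exact_mod_cast hgt
  omega

open Finset in
/-- The sum of the item and slack values over `S`, split into the two kinds of indices. -/
theorem sum_elim_neg_const {ι κ : Type*} (b : ι → ℝ) (B : ℝ) (S : Finset (ι ⊕ κ)) :
    ∑ x ∈ S, Sum.elim b (fun _ => -B) x = ∑ k ∈ S.toLeft, b k - S.toRight.card * B := by
  conv_lhs => rw [← toLeft_disjSum_toRight (u := S), sum_disjSum]
  simp [sub_eq_add_neg]

open Finset in
/-- A nonempty zero-sum set of indices contains a slack index. -/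
theorem toRight_nonempty_of_sum_eq_zero {ι κ : Type*} {b : ι → ℝ} (hb : ∀ k, 0 < b k) {B : ℝ}
    {S : Finset (ι ⊕ κ)} (hS : S.Nonempty) (h : ∑ x ∈ S, Sum.elim b (fun _ => -B) x = 0) :
    S.toRight.Nonempty := by
  by_contra hR
  rw [not_nonempty_iff_eq_empty] at hR
  rw [sum_elim_neg_const, hR, card_empty, Nat.cast_zero, zero_mul, sub_zero] at h
  have hL : S.toLeft.Nonempty := by
    obtain ⟨x | x, hx⟩ := hS
    · exact ⟨x, mem_toLeft.2 hx⟩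
    · exact absurd (mem_toRight.2 hx) (by simp [hR])
  exact (sum_pos (fun k _ => hb k) hL).ne' h

open Finset in
/-- If a partition of `ι ⊕ κ` has as many parts as `κ` has elements and every part meets `κ`,
then every part meets `κ` exactly once. -/
theorem card_toRight_eq_one {ι κ : Type*} [Fintype ι] [Fintype κ] [DecidableEq ι] [DecidableEq κ]
    {P : Finset (Finset (ι ⊕ κ))} (hcard : P.card = Fintype.card κ)
    (hdisj : (P : Set (Finset (ι ⊕ κ))).PairwiseDisjoint id) (hsup : P.sup id = univ)
    (hR : ∀ S ∈ P, S.toRight.Nonempty) : ∀ S ∈ P, S.toRight.card = 1 := by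
  have hunion : P.biUnion toRight = univ := by
    ext x
    have hx : Sum.inr x ∈ P.sup id := hsup ▸ mem_univ _
    simpa [mem_sup] using hx
  have hdisjR : (P : Set (Finset (ι ⊕ κ))).PairwiseDisjoint toRight := by
    intro S hS T hT hST
    refine disjoint_left.2 fun x hxS hxT => ?_
    exact disjoint_left.1 (hdisj hS hT hST) (mem_toRight.1 hxS) (mem_toRight.1 hxT)
  have hsum : ∑ _S ∈ P, 1 = ∑ S ∈ P, S.toRight.card := by
    rw [← card_biUnion hdisjR, hunion, card_univ, sum_const, smul_eq_mul, mul_one, hcard]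
  intro S hS
  exact ((sum_eq_sum_iff_of_le fun S hS => (hR S hS).card_pos).1 hsum S hS).symm

open Finset in
/-- Every part of a zero-sum partition into as many parts as there are slack indices consists of
one slack index and three items summing to `B`. -/
theorem zero_sum_part_structure {ι κ : Type*} [Fintype ι] [Fintype κ] [DecidableEq ι]
    [DecidableEq κ] {B : ℝ} (hB : 0 < B) {b : ι → ℝ} (hb : ∀ k, B / 4 < b k ∧ b k < B / 2)
    {P : Finset (Finset (ι ⊕ κ))} (hcard : P.card = Fintype.card κ) (hne : ∀ S ∈ P, S.Nonempty)
    (hdisj : (P : Set (Finset (ι ⊕ κ))).PairwiseDisjoint id) (hsup : P.sup id = univ)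
    (hzero : ∀ S ∈ P, ∑ x ∈ S, Sum.elim b (fun _ => -B) x = 0) {S : Finset (ι ⊕ κ)}
    (hS : S ∈ P) :
    S.toRight.card = 1 ∧ S.toLeft.card = 3 ∧ ∑ k ∈ S.toLeft, b k = B := by
  have hpos : ∀ k, 0 < b k := fun k => (by positivity : 0 < B / 4).trans (hb k).1
  have hone : S.toRight.card = 1 := card_toRight_eq_one hcard hdisj hsup
    (fun T hT => toRight_nonempty_of_sum_eq_zero hpos (hne T hT) (hzero T hT)) S hS
  have hsum : ∑ k ∈ S.toLeft, b k = B := by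
    have h := hzero S hS
    rw [sum_elim_neg_const, hone] at h
    push_cast at h
    linarith
  exact ⟨hone, card_eq_three_of_sum_eq hB hb hsum, hsum⟩

/-- the `4m` indices can be partitioned into `m` zero-sum parts iff
`{1,…,3m}` can be partitioned into `m` triples each summing to `B`; and in that case
each part of the zero-sum partition has exactly `4` elements: one slack index and a
triple of item indices summing to `B`. -/
theorem stmt12 (m : ℕ) (hm : 1 ≤ m) (B : ℝ) (hB : 0 < B)
    (b : Fin (3 * m) → ℝ) (hb : ∀ k, B / 4 < b k ∧ b k < B / 2) :
    ((∃ P : Finset (Finset (Fin (3 * m) ⊕ Fin m)),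
        P.card = m ∧
        (∀ S ∈ P, S.Nonempty) ∧
        (P : Set (Finset (Fin (3 * m) ⊕ Fin m))).PairwiseDisjoint id ∧
        P.sup id = Finset.univ ∧
        (∀ S ∈ P, ∑ x ∈ S, Sum.elim b (fun _ => -B) x = 0)) ↔
      (∃ Q : Finset (Finset (Fin (3 * m))),
        Q.card = m ∧
        (Q : Set (Finset (Fin (3 * m)))).PairwiseDisjoint id ∧
        Q.sup id = Finset.univ ∧
        (∀ S ∈ Q, S.card = 3 ∧ ∑ k ∈ S, b k = B))) ∧
    (∀ P : Finset (Finset (Fin (3 * m) ⊕ Fin m)),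
      P.card = m →
      (∀ S ∈ P, S.Nonempty) →
      (P : Set (Finset (Fin (3 * m) ⊕ Fin m))).PairwiseDisjoint id →
      P.sup id = Finset.univ →
      (∀ S ∈ P, ∑ x ∈ S, Sum.elim b (fun _ => -B) x = 0) →
      ∀ S ∈ P, S.card = 4 ∧
        (S.filter (fun x => x.isRight = true)).card = 1 ∧
        ∑ x ∈ S.filter (fun x => x.isLeft = true), Sum.elim b (fun _ => -B) x = B) := by
  refine ⟨⟨?_, ?_⟩, ?_⟩
  · rintro ⟨P, hcard, hne, hdisj, hsup, hzero⟩
    have hpart := fun S (hS : S ∈ P) =>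
      zero_sum_part_structure hB hb (by simpa using hcard) hne hdisj hsup hzero hS
    have hdisjL : ∀ S ∈ P, ∀ T ∈ P, S ≠ T → Disjoint S.toLeft T.toLeft := by
      intro S hS T hT hST
      refine Finset.disjoint_left.2 fun x hxS hxT => ?_
      exact Finset.disjoint_left.1 (hdisj hS hT hST) (Finset.mem_toLeft.1 hxS)
        (Finset.mem_toLeft.1 hxT)
    refine ⟨P.image Finset.toLeft, ?_, ?_, ?_, ?_⟩
    · rw [Finset.card_image_of_injOn, hcard]
      intro S hS T hT hST
      by_contra hne'
      have h := hdisjL S hS T hT hne'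
      rw [← show S.toLeft = T.toLeft from hST, disjoint_self, Finset.bot_eq_empty] at h
      have h3 := (hpart S hS).2.1
      simp [h] at h3
    · intro U hU V hV hUV
      obtain ⟨S, hS, rfl⟩ := Finset.mem_image.1 (Finset.mem_coe.1 hU)
      obtain ⟨T, hT, rfl⟩ := Finset.mem_image.1 (Finset.mem_coe.1 hV)
      exact hdisjL S hS T hT fun h => hUV (congrArg _ h)
    · ext x
      have hx : Sum.inl x ∈ P.sup id := hsup ▸ Finset.mem_univ _
      simpa [Finset.mem_sup] using hx
    · intro U hU
      obtain ⟨S, hS, rfl⟩ := Finset.mem_image.1 hU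
      exact (hpart S hS).2
  · rintro ⟨Q, hcard, hdisj, hsup, hQ⟩
    let e := Q.equivFinOfCardEq hcard
    let f : Fin m → Finset (Fin (3 * m) ⊕ Fin m) := fun i => (e.symm i).1.disjSum {i}
    have hf : ∀ i j, i ≠ j → Disjoint (f i) (f j) := by
      intro i j hij
      have hd : Disjoint (e.symm i).1 (e.symm j).1 := hdisj (e.symm i).2 (e.symm j).2
        fun h => hij (e.symm.injective (Subtype.ext h))
      refine Finset.disjoint_left.2 ?_
      rintro (x | x) hx hy
      · exact Finset.disjoint_left.1 hd (Finset.inl_mem_disjSum.1 hx) (Finset.inl_mem_disjSum.1 hy)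
      · exact hij ((Finset.mem_singleton.1 (Finset.inr_mem_disjSum.1 hx)).symm.trans
          (Finset.mem_singleton.1 (Finset.inr_mem_disjSum.1 hy)))
    have hmem : ∀ i, Sum.inr i ∈ f i := fun i => by simp [f]
    have hinj : Function.Injective f := by
      intro i j hij
      by_contra hne
      exact Finset.disjoint_left.1 (hf i j hne) (hmem i) (hij ▸ hmem i)
    refine ⟨Finset.univ.image f, ?_, ?_, ?_, ?_, ?_⟩
    · rw [Finset.card_image_of_injective _ hinj, Finset.card_univ, Fintype.card_fin]
    · intro S hS
      obtain ⟨i, -, rfl⟩ := Finset.mem_image.1 hS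
      exact ⟨_, hmem i⟩
    · intro S hS T hT hST
      obtain ⟨i, -, rfl⟩ := Finset.mem_image.1 (Finset.mem_coe.1 hS)
      obtain ⟨j, -, rfl⟩ := Finset.mem_image.1 (Finset.mem_coe.1 hT)
      exact hf i j fun h => hST (congrArg f h)
    · refine Finset.eq_univ_iff_forall.2 ?_
      rintro (x | i)
      · have hx : x ∈ Q.sup id := hsup ▸ Finset.mem_univ _
        obtain ⟨S, hS, hxS⟩ := Finset.mem_sup.1 hx
        refine Finset.mem_sup.2 ⟨f (e ⟨S, hS⟩), Finset.mem_image_of_mem f (Finset.mem_univ _), ?_⟩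
        simpa [f] using hxS
      · exact Finset.mem_sup.2 ⟨f i, Finset.mem_image_of_mem f (Finset.mem_univ _), hmem i⟩
    · intro S hS
      obtain ⟨i, -, rfl⟩ := Finset.mem_image.1 hS
      rw [sum_elim_neg_const]
      simp [f, (hQ _ (e.symm i).2).2]
  · intro P hcard hne hdisj hsup hzero S hS
    obtain ⟨hR, hL, hsum⟩ :=
      zero_sum_part_structure hB hb (by simpa using hcard) hne hdisj hsup hzero hS
    have hfR : S.filter (fun x => x.isRight = true) = S.toRight.map .inr := by
      ext (x | x) <;> simp
    have hfL : S.filter (fun x => x.isLeft = true) = S.toLeft.map .inl := by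
      ext (x | x) <;> simp
    refine ⟨?_, ?_, ?_⟩
    · rw [← Finset.card_toLeft_add_card_toRight, hL, hR]
    · rw [hfR, Finset.card_map, hR]
    · rw [hfL, Finset.sum_map]
      exact hsum
end

section
/- For any rectangle solution for A with weights w, and any 0 ≤ i ≤ m and 0 ≤ j ≤ n, Δ_{ij} = Σ_{i_2 ≥ i+1, j_2 ≥ j+1} w(i+1, i_2, j+1, j_2) + Σ_{i_1 ≤ i, j_1 ≤ j} w(i_1, i, j_1, j) − Σ_{i_2 ≥ i+1, j_1 ≤ j} w(i+1, i_2, j_1, j) − Σ_{i_1 ≤ i, j_2 ≥ j+1} w(i_1, i, j+1, j_2); i.e., only rectangles having a corner at the grid point (i,j) contribute to Δ_{ij}. -/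
/-- A rectangle solution for the (zero-padded) matrix `a`: weights on the rectangles
`Rect(i₁,i₂,j₁,j₂)`, `1 ≤ i₁ ≤ i₂ ≤ m`, `1 ≤ j₁ ≤ j₂ ≤ n`, such that for every cell
`(i,j) ∈ {1,…,m}×{1,…,n}` the weights of the rectangles containing `(i,j)` sum to `a i j`. -/
def RSol (m n : ℤ) (a : ℤ → ℤ → ℝ) (w : ℤ → ℤ → ℤ → ℤ → ℝ) : Prop :=
  (∀ i₁ i₂ j₁ j₂ : ℤ,
      ¬(1 ≤ i₁ ∧ i₁ ≤ i₂ ∧ i₂ ≤ m ∧ 1 ≤ j₁ ∧ j₁ ≤ j₂ ∧ j₂ ≤ n) → w i₁ i₂ j₁ j₂ = 0) ∧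
  (∀ i ∈ Finset.Icc (1 : ℤ) m, ∀ j ∈ Finset.Icc (1 : ℤ) n,
      ∑ i₁ ∈ Finset.Icc 1 i, ∑ i₂ ∈ Finset.Icc i m,
        ∑ j₁ ∈ Finset.Icc 1 j, ∑ j₂ ∈ Finset.Icc j n, w i₁ i₂ j₁ j₂ = a i j)

/-- Size of a rectangle solution: number of rectangles with nonzero weight. -/
noncomputable def rsize (w : ℤ → ℤ → ℤ → ℤ → ℝ) : ℕ :=
  {q : ℤ × ℤ × ℤ × ℤ | w q.1 q.2.1 q.2.2.1 q.2.2.2 ≠ 0}.ncard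

/-- `Δ_{ij} = a_{i,j} - a_{i,j+1} + a_{i+1,j+1} - a_{i+1,j}`. -/
def Dlt2 (a : ℤ → ℤ → ℝ) (i j : ℤ) : ℝ :=
  a i j - a i (j + 1) + a (i + 1) (j + 1) - a (i + 1) j

/-- The number of array corners of `a`. -/
noncomputable def corners (m n : ℤ) (a : ℤ → ℤ → ℝ) : ℕ :=
  {p : ℤ × ℤ | 0 ≤ p.1 ∧ p.1 ≤ m ∧ 0 ≤ p.2 ∧ p.2 ≤ n ∧ Dlt2 a p.1 p.2 ≠ 0}.ncard

/-- As the point `k` moves from `i` to `i + 1`, the total weight of the intervals `[p, q]`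
containing `k` gains the intervals starting at `i + 1` and loses those ending at `i`. -/
theorem sum_intervals_succ_sub (m : ℤ) (f : ℤ → ℤ → ℝ) {i : ℤ} (hi : 0 ≤ i) (him : i ≤ m) :
    (∑ p ∈ Finset.Icc 1 (i + 1), ∑ q ∈ Finset.Icc (i + 1) m, f p q) -
        ∑ p ∈ Finset.Icc 1 i, ∑ q ∈ Finset.Icc i m, f p q =
      ∑ q ∈ Finset.Icc (i + 1) m, f (i + 1) q - ∑ p ∈ Finset.Icc 1 i, f p i := by
  have hstart : Finset.Icc 1 (i + 1) = insert (i + 1) (Finset.Icc 1 i) := by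
    ext x; simp only [Finset.mem_Icc, Finset.mem_insert]; omega
  have hend : Finset.Icc i m = insert i (Finset.Icc (i + 1) m) := by
    ext x; simp only [Finset.mem_Icc, Finset.mem_insert]; omega
  rw [hstart, hend, Finset.sum_insert (by simp)]
  simp_rw [Finset.sum_insert (show i ∉ Finset.Icc (i + 1) m by simp), Finset.sum_add_distrib]
  ring

/-- The covering equations extend to all cells, both sides vanishing outside the array. -/
theorem RSol.sum_eq {m n : ℤ} {a : ℤ → ℤ → ℝ} {w : ℤ → ℤ → ℤ → ℤ → ℝ} (hw : RSol m n a w)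
    (ha : ∀ i j : ℤ, ¬(1 ≤ i ∧ i ≤ m ∧ 1 ≤ j ∧ j ≤ n) → a i j = 0) (i j : ℤ) :
    a i j = ∑ i₁ ∈ Finset.Icc 1 i, ∑ i₂ ∈ Finset.Icc i m,
      ∑ j₁ ∈ Finset.Icc 1 j, ∑ j₂ ∈ Finset.Icc j n, w i₁ i₂ j₁ j₂ := by
  by_cases h : 1 ≤ i ∧ i ≤ m ∧ 1 ≤ j ∧ j ≤ n
  · exact (hw.2 i (Finset.mem_Icc.2 ⟨h.1, h.2.1⟩) j (Finset.mem_Icc.2 h.2.2)).symm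
  · rw [ha i j h]
    symm
    refine Finset.sum_eq_zero fun i₁ hi₁ => Finset.sum_eq_zero fun i₂ hi₂ =>
      Finset.sum_eq_zero fun j₁ hj₁ => Finset.sum_eq_zero fun j₂ hj₂ => ?_
    simp only [Finset.mem_Icc] at hi₁ hi₂ hj₁ hj₂
    omega

/-- only rectangles having a corner at grid point `(i,j)` contribute to
`Δ_{ij}`. -/
theorem stmt13 (m n : ℤ) (hm : 1 ≤ m) (hn : 1 ≤ n) (a : ℤ → ℤ → ℝ)
    (ha : ∀ i j : ℤ, ¬(1 ≤ i ∧ i ≤ m ∧ 1 ≤ j ∧ j ≤ n) → a i j = 0)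
    (w : ℤ → ℤ → ℤ → ℤ → ℝ) (hw : RSol m n a w) :
    ∀ i ∈ Finset.Icc (0 : ℤ) m, ∀ j ∈ Finset.Icc (0 : ℤ) n,
      Dlt2 a i j =
        (∑ i₂ ∈ Finset.Icc (i + 1) m, ∑ j₂ ∈ Finset.Icc (j + 1) n, w (i + 1) i₂ (j + 1) j₂) +
        (∑ i₁ ∈ Finset.Icc 1 i, ∑ j₁ ∈ Finset.Icc 1 j, w i₁ i j₁ j) -
        (∑ i₂ ∈ Finset.Icc (i + 1) m, ∑ j₁ ∈ Finset.Icc 1 j, w (i + 1) i₂ j₁ j) -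
        (∑ i₁ ∈ Finset.Icc 1 i, ∑ j₂ ∈ Finset.Icc (j + 1) n, w i₁ i (j + 1) j₂) := by
  intro i hi j hj
  rw [Finset.mem_Icc] at hi hj
  have hrow (j' : ℤ) := sum_intervals_succ_sub m
    (fun i₁ i₂ => ∑ j₁ ∈ Finset.Icc 1 j', ∑ j₂ ∈ Finset.Icc j' n, w i₁ i₂ j₁ j₂) hi.1 hi.2
  simp only [← hw.sum_eq ha] at hrow
  have hcol (i₁ i₂ : ℤ) := sum_intervals_succ_sub n (w i₁ i₂) hj.1 hj.2
  have hstart := Finset.sum_congr rfl fun i₂ (_ : i₂ ∈ Finset.Icc (i + 1) m) => hcol (i + 1) i₂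
  have hend := Finset.sum_congr rfl fun i₁ (_ : i₁ ∈ Finset.Icc 1 i) => hcol i₁ i
  simp only [Finset.sum_sub_distrib] at hstart hend
  unfold Dlt2
  linarith [hrow j, hrow (j + 1)]
end

section
/- Every rectangle solution for A has size at least one quarter of the number of array corners of A, i.e., size ≥ (1/4)·|{(i,j) : 0 ≤ i ≤ m, 0 ≤ j ≤ n, Δ_{ij} ≠ 0}|. -/
/-- The value at the cell `(i, j)` of the indicator function of the rectangle
`q = (i₁, i₂, j₁, j₂)`. -/
noncomputable def rectIndicator (q : ℤ × ℤ × ℤ × ℤ) (i j : ℤ) : ℝ :=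
  if (q.1 ≤ i ∧ i ≤ q.2.1) ∧ q.2.2.1 ≤ j ∧ j ≤ q.2.2.2 then 1 else 0

/-- The four array corners of the rectangle `q = (i₁, i₂, j₁, j₂)`. -/
def rectCorners (q : ℤ × ℤ × ℤ × ℤ) : Finset (ℤ × ℤ) :=
  {q.1 - 1, q.2.1} ×ˢ {q.2.2.1 - 1, q.2.2.2}

lemma card_rectCorners_le (q : ℤ × ℤ × ℤ × ℤ) : (rectCorners q).card ≤ 4 := by
  rw [rectCorners, Finset.card_product]
  exact Nat.mul_le_mul Finset.card_le_two Finset.card_le_two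

lemma Dlt2_rectIndicator_eq_zero {q : ℤ × ℤ × ℤ × ℤ} {i j : ℤ} (h : (i, j) ∉ rectCorners q) :
    Dlt2 (rectIndicator q) i j = 0 := by
  simp only [rectCorners, Finset.mem_product, Finset.mem_insert, Finset.mem_singleton,
    not_and_or, not_or] at h
  unfold Dlt2 rectIndicator
  rcases h with h | h
  · have hi : (q.1 ≤ i + 1 ∧ i + 1 ≤ q.2.1) ↔ (q.1 ≤ i ∧ i ≤ q.2.1) := by omega
    simp only [hi]
    ring
  · have hj : (q.2.2.1 ≤ j + 1 ∧ j + 1 ≤ q.2.2.2) ↔ (q.2.2.1 ≤ j ∧ j ≤ q.2.2.2) := by omega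
    simp only [hj]
    ring

/-- A finite box containing all rectangles of an `m × n` matrix. -/
noncomputable def rectBox (m n : ℤ) : Finset (ℤ × ℤ × ℤ × ℤ) :=
  Finset.Icc 1 m ×ˢ Finset.Icc 1 m ×ˢ Finset.Icc 1 n ×ˢ Finset.Icc 1 n

lemma RSol.eq_sum_rectIndicator {m n : ℤ} {a : ℤ → ℤ → ℝ} {w : ℤ → ℤ → ℤ → ℤ → ℝ}
    (hw : RSol m n a w)
    (ha : ∀ i j : ℤ, ¬(1 ≤ i ∧ i ≤ m ∧ 1 ≤ j ∧ j ≤ n) → a i j = 0) (i j : ℤ) :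
    a i j = ∑ q ∈ rectBox m n, w q.1 q.2.1 q.2.2.1 q.2.2.2 * rectIndicator q i j := by
  simp only [rectIndicator, mul_ite, mul_one, mul_zero]
  rw [← Finset.sum_filter]
  by_cases hij : 1 ≤ i ∧ i ≤ m ∧ 1 ≤ j ∧ j ≤ n
  · rw [← hw.2 i (Finset.mem_Icc.2 ⟨hij.1, hij.2.1⟩) j (Finset.mem_Icc.2 hij.2.2)]
    simp only [← Finset.sum_product']
    refine Finset.sum_congr ?_ fun _ _ => rfl
    ext q
    simp only [rectBox, Finset.mem_product, Finset.mem_Icc, Finset.mem_filter]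
    omega
  · rw [ha i j hij, eq_comm]
    refine Finset.sum_eq_zero fun q hq => ?_
    simp only [rectBox, Finset.mem_product, Finset.mem_Icc, Finset.mem_filter] at hq
    omega

lemma RSol.Dlt2_eq_sum {m n : ℤ} {a : ℤ → ℤ → ℝ} {w : ℤ → ℤ → ℤ → ℤ → ℝ}
    (hw : RSol m n a w)
    (ha : ∀ i j : ℤ, ¬(1 ≤ i ∧ i ≤ m ∧ 1 ≤ j ∧ j ≤ n) → a i j = 0) (i j : ℤ) :
    Dlt2 a i j =
      ∑ q ∈ rectBox m n, w q.1 q.2.1 q.2.2.1 q.2.2.2 * Dlt2 (rectIndicator q) i j := by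
  simp only [Dlt2, hw.eq_sum_rectIndicator ha, ← Finset.sum_sub_distrib,
    ← Finset.sum_add_distrib]
  exact Finset.sum_congr rfl fun _ _ => by ring

/-- every rectangle solution has size at least a quarter of the number of
array corners. -/
theorem stmt14 (m n : ℤ) (hm : 1 ≤ m) (hn : 1 ≤ n) (a : ℤ → ℤ → ℝ)
    (ha : ∀ i j : ℤ, ¬(1 ≤ i ∧ i ≤ m ∧ 1 ≤ j ∧ j ≤ n) → a i j = 0)
    (w : ℤ → ℤ → ℤ → ℤ → ℝ) (hw : RSol m n a w) :
    corners m n a ≤ 4 * rsize w := by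
  classical
  set S := (rectBox m n).filter fun q => w q.1 q.2.1 q.2.2.1 q.2.2.2 ≠ 0 with hS
  have hsize : rsize w = S.card := by
    rw [rsize, ← Set.ncard_coe_finset]
    congr 1
    ext q
    simp only [hS, Set.mem_ofPred_eq, Finset.coe_filter, iff_and_self]
    intro hq
    have h := not_imp_comm.1 (hw.1 q.1 q.2.1 q.2.2.1 q.2.2.2) hq
    simp only [rectBox, Finset.mem_product, Finset.mem_Icc]
    omega
  have hsub : {p : ℤ × ℤ | 0 ≤ p.1 ∧ p.1 ≤ m ∧ 0 ≤ p.2 ∧ p.2 ≤ n ∧ Dlt2 a p.1 p.2 ≠ 0} ⊆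
      (S.biUnion rectCorners : Finset (ℤ × ℤ)) := by
    rintro ⟨i, j⟩ ⟨-, -, -, -, hp⟩
    rw [hw.Dlt2_eq_sum ha] at hp
    obtain ⟨q, hq, hne⟩ := Finset.exists_ne_zero_of_sum_ne_zero hp
    exact Finset.mem_biUnion.2 ⟨q, Finset.mem_filter.2 ⟨hq, left_ne_zero_of_mul hne⟩,
      not_imp_comm.1 Dlt2_rectIndicator_eq_zero (right_ne_zero_of_mul hne)⟩
  calc corners m n a ≤ (S.biUnion rectCorners).card := by
        rw [corners, ← Set.ncard_coe_finset]
        exact Set.ncard_le_ncard hsub (Finset.finite_toSet _)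
    _ ≤ S.card * 4 := Finset.card_biUnion_le_card_mul _ _ _ fun q _ => card_rectCorners_le q
    _ = 4 * rsize w := by rw [hsize, mul_comm]
end

section
/- For every m×n real matrix A there exists a rectangle solution for A whose size is at most the number of array corners of A, i.e., at most |{(i,j) : 0 ≤ i ≤ m, 0 ≤ j ≤ n, Δ_{ij} ≠ 0}|. (This yields a 4-approximation, by the corner lower bound.) -/
/-- A telescoping sum over an integer interval. -/
theorem sum_Icc_int_sub_succ (f : ℤ → ℝ) (m i : ℤ) (h : i ≤ m + 1) :
    ∑ k ∈ Finset.Icc i m, (f k - f (k + 1)) = f i - f (m + 1) := by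
  induction i, h using Int.leInductionDown with
  | base => simp
  | pred i hi ih =>
    have hins : Finset.Icc (i - 1) m = insert (i - 1) (Finset.Icc i m) := by
      ext x
      simp only [Finset.mem_Icc, Finset.mem_insert]
      omega
    rw [hins, Finset.sum_insert (by simp), ih, sub_add_cancel]
    ring

/-- Summing `Δ` over the quadrant of cells beyond `(i, j)` recovers a zero-padded matrix. -/
theorem sum_Dlt2 (m n : ℤ) (a : ℤ → ℤ → ℝ)
    (ha : ∀ i j : ℤ, ¬(1 ≤ i ∧ i ≤ m ∧ 1 ≤ j ∧ j ≤ n) → a i j = 0)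
    (i j : ℤ) (hi : i ≤ m) (hj : j ≤ n) :
    ∑ k ∈ Finset.Icc i m, ∑ l ∈ Finset.Icc j n, Dlt2 a k l = a i j := by
  have inner (k : ℤ) : ∑ l ∈ Finset.Icc j n, Dlt2 a k l = a k j - a (k + 1) j := by
    have h := sum_Icc_int_sub_succ (fun l => a k l - a (k + 1) l) n j (by omega)
    rw [ha k (n + 1) (by omega), ha (k + 1) (n + 1) (by omega), sub_zero, sub_zero] at h
    rw [← h]
    refine Finset.sum_congr rfl fun l _ => ?_
    unfold Dlt2
    ring
  simp_rw [inner]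
  rw [sum_Icc_int_sub_succ (fun k => a k j) m i (by omega), ha (m + 1) j (by omega), sub_zero]

/-- The weights giving `Rect(1,i,1,j)` weight `Δ_{ij}`, and `0` to every other rectangle. -/
noncomputable def cornerWeight (m n : ℤ) (a : ℤ → ℤ → ℝ) (i₁ i₂ j₁ j₂ : ℤ) : ℝ :=
  if i₁ = 1 then
    if j₁ = 1 then
      if 1 ≤ i₂ ∧ i₂ ≤ m ∧ 1 ≤ j₂ ∧ j₂ ≤ n then Dlt2 a i₂ j₂ else 0
    else 0
  else 0

theorem rSol_cornerWeight (m n : ℤ) (a : ℤ → ℤ → ℝ)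
    (ha : ∀ i j : ℤ, ¬(1 ≤ i ∧ i ≤ m ∧ 1 ≤ j ∧ j ≤ n) → a i j = 0) :
    RSol m n a (cornerWeight m n a) := by
  refine ⟨fun i₁ i₂ j₁ j₂ h => ?_, fun i hi j hj => ?_⟩
  · unfold cornerWeight
    split_ifs <;> first | rfl | omega
  · rw [Finset.mem_Icc] at hi hj
    rw [← sum_Dlt2 m n a ha i j hi.2 hj.2,
      Finset.sum_eq_single_of_mem 1 (by simp [hi.1]) (fun x _ hx => by simp [cornerWeight, hx])]
    refine Finset.sum_congr rfl fun k hk => ?_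
    rw [Finset.sum_eq_single_of_mem 1 (by simp [hj.1]) (fun x _ hx => by simp [cornerWeight, hx])]
    refine Finset.sum_congr rfl fun l hl => ?_
    rw [Finset.mem_Icc] at hk hl
    rw [cornerWeight, if_pos rfl, if_pos rfl, if_pos (by omega)]

theorem rsize_cornerWeight_le (m n : ℤ) (a : ℤ → ℤ → ℝ) :
    rsize (cornerWeight m n a) ≤ corners m n a := by
  refine Set.ncard_le_ncard_of_injOn (fun q => (q.2.1, q.2.2.2)) ?_ ?_ ?_
  · rintro ⟨i₁, i₂, j₁, j₂⟩ h
    simp only [Set.mem_ofPred_eq, cornerWeight, ne_eq, ite_eq_right_iff, Classical.not_imp] at h ⊢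
    obtain ⟨-, -, h, hd⟩ := h
    exact ⟨by omega, by omega, by omega, by omega, hd⟩
  · rintro ⟨i₁, i₂, j₁, j₂⟩ h ⟨i₁', i₂', j₁', j₂'⟩ h' heq
    simp only [Set.mem_ofPred_eq, cornerWeight, ne_eq, ite_eq_right_iff, Classical.not_imp] at h h'
    simp only [Prod.mk.injEq] at heq ⊢
    exact ⟨h.1.trans h'.1.symm, heq.1, h.2.1.trans h'.2.1.symm, heq.2⟩
  · refine (Set.finite_Icc ((0 : ℤ), (0 : ℤ)) (m, n)).subset ?_
    rintro ⟨i, j⟩ ⟨hi, hi', hj, hj', -⟩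
    exact ⟨⟨hi, hj⟩, ⟨hi', hj'⟩⟩

/-- there is a rectangle solution whose size is at most the number of
array corners. -/
theorem stmt15 (m n : ℤ) (hm : 1 ≤ m) (hn : 1 ≤ n) (a : ℤ → ℤ → ℝ)
    (ha : ∀ i j : ℤ, ¬(1 ≤ i ∧ i ≤ m ∧ 1 ≤ j ∧ j ≤ n) → a i j = 0) :
    ∃ w : ℤ → ℤ → ℤ → ℤ → ℝ, RSol m n a w ∧ rsize w ≤ corners m n a := by
  exact ⟨cornerWeight m n a, rSol_cornerWeight m n a ha, rsize_cornerWeight_le m n a⟩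
end

section
/- For each 0 ≤ i ≤ m let OPT^i be the minimum number of nonzero weights in an assignment of real weights u_{j_1 j_2} to the intervals [j_1,j_2] with 1 ≤ j_1 ≤ j_2 ≤ n satisfying, for every 0 ≤ j ≤ n, Δ_{ij} = Σ_{j_2 ≥ j+1} u_{j+1,j_2} − Σ_{j_1 ≤ j} u_{j_1,j}. Then every rectangle solution for A has size at least (1/2)·Σ_{i=0}^{m} OPT^i (each rectangle touches exactly two horizontal grid lines). -/
/-- The minimum number of nonzero interval weights realizing the `Δ`-values on the
`i`-th horizontal grid line. -/
noncomputable def OPTline (n : ℤ) (a : ℤ → ℤ → ℝ) (i : ℤ) : ℕ :=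
  sInf {K : ℕ | ∃ u : ℤ → ℤ → ℝ,
    (∀ j₁ j₂ : ℤ, ¬(1 ≤ j₁ ∧ j₁ ≤ j₂ ∧ j₂ ≤ n) → u j₁ j₂ = 0) ∧
    (∀ j ∈ Finset.Icc (0 : ℤ) n,
      Dlt2 a i j =
        ∑ j₂ ∈ Finset.Icc (j + 1) n, u (j + 1) j₂ - ∑ j₁ ∈ Finset.Icc 1 j, u j₁ j) ∧
    {p : ℤ × ℤ | u p.1 p.2 ≠ 0}.ncard = K}

/-- The total weight of the intervals `[x, y] ⊆ [1, N]` containing `k`. -/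
noncomputable def coverSum (N : ℤ) (f : ℤ → ℤ → ℝ) (k : ℤ) : ℝ :=
  ∑ x ∈ Finset.Icc 1 k, ∑ y ∈ Finset.Icc k N, f x y

/-- The weight of the intervals starting at `k + 1` minus that of the intervals ending at `k`. -/
noncomputable def endpointSum (N : ℤ) (f : ℤ → ℤ → ℝ) (k : ℤ) : ℝ :=
  ∑ y ∈ Finset.Icc (k + 1) N, f (k + 1) y - ∑ x ∈ Finset.Icc 1 k, f x k

lemma coverSum_succ_sub (N : ℤ) (f : ℤ → ℤ → ℝ) {k : ℤ} (h0 : 0 ≤ k) (hN : k ≤ N) :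
    coverSum N f (k + 1) - coverSum N f k = endpointSum N f k := by
  have hl : Finset.Icc 1 (k + 1) = insert (k + 1) (Finset.Icc 1 k) := by
    ext x; simp only [Finset.mem_Icc, Finset.mem_insert]; omega
  have hr : Finset.Icc k N = insert k (Finset.Icc (k + 1) N) := by
    ext x; simp only [Finset.mem_Icc, Finset.mem_insert]; omega
  have hr' (x : ℤ) : ∑ y ∈ Finset.Icc k N, f x y = f x k + ∑ y ∈ Finset.Icc (k + 1) N, f x y := by
    rw [hr, Finset.sum_insert (by simp)]
  unfold coverSum endpointSum
  rw [hl, Finset.sum_insert (by simp), Finset.sum_congr rfl fun x _ => hr' x,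
    Finset.sum_add_distrib]
  ring

lemma coverSum_sub (N : ℤ) (f g : ℤ → ℤ → ℝ) (k : ℤ) :
    coverSum N (fun x y => f x y - g x y) k = coverSum N f k - coverSum N g k := by
  simp [coverSum, Finset.sum_sub_distrib]

lemma endpointSum_comm (M N : ℤ) (w : ℤ → ℤ → ℤ → ℤ → ℝ) (i j : ℤ) :
    endpointSum M (fun i₁ i₂ => endpointSum N (w i₁ i₂) j) i =
      endpointSum N (fun j₁ j₂ => endpointSum M (fun i₁ i₂ => w i₁ i₂ j₁ j₂) i) j := by
  simp only [endpointSum, Finset.sum_sub_distrib]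
  rw [Finset.sum_comm (s := Finset.Icc (i + 1) M) (t := Finset.Icc (j + 1) N),
    Finset.sum_comm (s := Finset.Icc (i + 1) M) (t := Finset.Icc 1 j),
    Finset.sum_comm (s := Finset.Icc 1 i) (t := Finset.Icc (j + 1) N),
    Finset.sum_comm (s := Finset.Icc 1 i) (t := Finset.Icc 1 j)]
  ring

lemma RSol.eq_coverSum {m n : ℤ} {a : ℤ → ℤ → ℝ} {w : ℤ → ℤ → ℤ → ℤ → ℝ} (hw : RSol m n a w)
    (ha : ∀ i j : ℤ, ¬(1 ≤ i ∧ i ≤ m ∧ 1 ≤ j ∧ j ≤ n) → a i j = 0) (i j : ℤ) :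
    a i j = coverSum m (fun i₁ i₂ => coverSum n (w i₁ i₂) j) i := by
  by_cases h : 1 ≤ i ∧ i ≤ m ∧ 1 ≤ j ∧ j ≤ n
  · exact (hw.2 i (by simp [h]) j (by simp [h])).symm
  · rw [ha i j h]
    refine (Finset.sum_eq_zero fun x hx => Finset.sum_eq_zero fun y hy => ?_).symm
    refine Finset.sum_eq_zero fun x' hx' => Finset.sum_eq_zero fun y' hy' => ?_
    simp only [Finset.mem_Icc] at hx hy hx' hy'
    omega

lemma RSol.dlt2_eq {m n : ℤ} {a : ℤ → ℤ → ℝ} {w : ℤ → ℤ → ℤ → ℤ → ℝ} (hw : RSol m n a w)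
    (ha : ∀ i j : ℤ, ¬(1 ≤ i ∧ i ≤ m ∧ 1 ≤ j ∧ j ≤ n) → a i j = 0) {i j : ℤ}
    (hi : i ∈ Finset.Icc 0 m) (hj : j ∈ Finset.Icc 0 n) :
    Dlt2 a i j =
      endpointSum n (fun j₁ j₂ => endpointSum m (fun i₁ i₂ => w i₁ i₂ j₁ j₂) i) j := by
  rw [Finset.mem_Icc] at hi hj
  have hrow (k : ℤ) : a k (j + 1) - a k j =
      coverSum m (fun i₁ i₂ => endpointSum n (w i₁ i₂) j) k := by
    simp only [hw.eq_coverSum ha, ← coverSum_sub, coverSum_succ_sub n _ hj.1 hj.2]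
  rw [← endpointSum_comm, ← coverSum_succ_sub m _ hi.1 hi.2, ← hrow, ← hrow, Dlt2]
  ring

lemma RSol.finite_support {m n : ℤ} {a : ℤ → ℤ → ℝ} {w : ℤ → ℤ → ℤ → ℤ → ℝ}
    (hw : RSol m n a w) :
    {q : ℤ × ℤ × ℤ × ℤ | w q.1 q.2.1 q.2.2.1 q.2.2.2 ≠ 0}.Finite := by
  refine (Set.finite_Icc ((1, 1, 1, 1) : ℤ × ℤ × ℤ × ℤ) (m, m, n, n)).subset fun q hq => ?_
  have := not_imp_comm.1 (hw.1 q.1 q.2.1 q.2.2.1 q.2.2.2) hq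
  simp only [Set.mem_Icc, Prod.le_def]
  omega

lemma OPTline_le {m n : ℤ} {a : ℤ → ℤ → ℝ} {w : ℤ → ℤ → ℤ → ℤ → ℝ} (hw : RSol m n a w)
    (ha : ∀ i j : ℤ, ¬(1 ≤ i ∧ i ≤ m ∧ 1 ≤ j ∧ j ≤ n) → a i j = 0) {i : ℤ}
    (hi : i ∈ Finset.Icc 0 m) :
    OPTline n a i ≤ (hw.finite_support.toFinset.filter fun q => q.1 - 1 = i).card +
      (hw.finite_support.toFinset.filter fun q => q.2.1 = i).card := by
  classical
  unfold OPTline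
  refine le_trans (Nat.sInf_le ⟨fun j₁ j₂ => endpointSum m (fun i₁ i₂ => w i₁ i₂ j₁ j₂) i,
    fun j₁ j₂ h => ?_, fun j hj => hw.dlt2_eq ha hi hj, rfl⟩) ?_
  · simp only [endpointSum]
    rw [Finset.sum_eq_zero fun _ _ => hw.1 _ _ _ _ (by tauto),
      Finset.sum_eq_zero fun _ _ => hw.1 _ _ _ _ (by tauto), sub_zero]
  · refine le_trans ?_ (Finset.card_union_le _ _)
    refine le_trans ?_ (Finset.card_image_le (f := fun q : ℤ × ℤ × ℤ × ℤ => q.2.2))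
    rw [← Set.ncard_coe_finset]
    refine Set.ncard_le_ncard (fun p hp => ?_) (Finset.finite_toSet _)
    by_contra hne
    simp only [Finset.coe_image, Set.mem_image, Finset.mem_coe, Finset.mem_union,
      Finset.mem_filter, Set.Finite.mem_toFinset, Set.mem_ofPred_eq, not_exists] at hne
    refine hp ?_
    simp only [endpointSum]
    rw [Finset.sum_eq_zero fun y _ => ?_, Finset.sum_eq_zero fun x _ => ?_, sub_zero]
    · by_contra h
      exact hne (x, i, p) ⟨Or.inr ⟨h, rfl⟩, rfl⟩
    · by_contra h
      exact hne (i + 1, y, p) ⟨Or.inl ⟨h, by simp⟩, rfl⟩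

/-- every rectangle solution has size at least `(1/2)·∑_{i=0}^m OPTⁱ`. -/
theorem stmt17 (m n : ℤ) (hm : 1 ≤ m) (hn : 1 ≤ n) (a : ℤ → ℤ → ℝ)
    (ha : ∀ i j : ℤ, ¬(1 ≤ i ∧ i ≤ m ∧ 1 ≤ j ∧ j ≤ n) → a i j = 0)
    (w : ℤ → ℤ → ℤ → ℤ → ℝ) (hw : RSol m n a w) :
    ∑ i ∈ Finset.Icc (0 : ℤ) m, OPTline n a i ≤ 2 * rsize w := by
  refine (Finset.sum_le_sum fun i hi => OPTline_le hw ha hi).trans ?_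
  rw [Finset.sum_add_distrib, ← Finset.card_eq_sum_card_fiberwise,
    ← Finset.card_eq_sum_card_fiberwise, rsize, Set.ncard_eq_toFinset_card _ hw.finite_support,
    two_mul]
  all_goals
    intro q hq
    rw [Finset.mem_coe, Set.Finite.mem_toFinset] at hq
    have := not_imp_comm.1 (hw.1 q.1 q.2.1 q.2.2.1 q.2.2.2) hq
    simp only [Finset.coe_Icc, Set.mem_Icc]
    omega
end

section
/- Let M ≥ 1 and let (a_{ij}) be an M×M matrix with entries in {0,1} such that for all i_1 ≠ i_2 and j_1 ≠ j_2, at most three of the four values a_{i_1 j_1}, a_{i_1 j_2}, a_{i_2 j_1}, a_{i_2 j_2} equal 1. Then the total number of ones in the matrix is at most 3·M^{3/2}. -/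
/-- Two distinct rows of a 0-1 matrix without all-ones rectangles share at most one `1`. -/
lemma sum_mul_rows_le_one {ι κ : Type*} [Fintype κ] (a : ι → κ → ℝ)
    (h01 : ∀ i j, a i j = 0 ∨ a i j = 1) {i₁ i₂ : ι}
    (h : ∀ j₁ j₂, j₁ ≠ j₂ → ¬(a i₁ j₁ = 1 ∧ a i₁ j₂ = 1 ∧ a i₂ j₁ = 1 ∧ a i₂ j₂ = 1)) :
    ∑ j, a i₁ j * a i₂ j ≤ 1 := by
  classical
  have hprod : ∀ j, a i₁ j * a i₂ j = if a i₁ j = 1 ∧ a i₂ j = 1 then 1 else 0 := by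
    intro j
    rcases h01 i₁ j with h1 | h1 <;> rcases h01 i₂ j with h2 | h2 <;> simp [h1, h2]
  rw [Finset.sum_congr rfl fun j _ => hprod j, Finset.sum_boole]
  norm_cast
  refine Finset.card_le_one.2 fun j₁ hj₁ j₂ hj₂ => ?_
  simp only [Finset.mem_filter, Finset.mem_univ, true_and] at hj₁ hj₂
  by_contra hne
  exact h j₁ j₂ hne ⟨hj₁.1, hj₂.1, hj₁.2, hj₂.2⟩

/-- The Kővári–Sós–Turán inequality for the entry sum of a 0-1 matrix without all-ones
rectangles. -/
lemma sq_sum_le_of_rectangle_free {ι κ : Type*} [Fintype ι] [Fintype κ] (a : ι → κ → ℝ)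
    (h01 : ∀ i j, a i j = 0 ∨ a i j = 1)
    (h : ∀ i₁ i₂ j₁ j₂, i₁ ≠ i₂ → j₁ ≠ j₂ →
      ¬(a i₁ j₁ = 1 ∧ a i₁ j₂ = 1 ∧ a i₂ j₁ = 1 ∧ a i₂ j₂ = 1)) :
    (∑ i, ∑ j, a i j) ^ 2 ≤
      Fintype.card κ * (∑ i, ∑ j, a i j + (Fintype.card ι : ℝ) ^ 2) := by
  classical
  have hpair : ∀ i₁ i₂, ∑ j, a i₁ j * a i₂ j ≤ (if i₁ = i₂ then ∑ j, a i₁ j else 0) + 1 := by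
    intro i₁ i₂
    split_ifs with hi
    · subst hi
      have hsq : ∀ j, a i₁ j * a i₁ j = a i₁ j := fun j => by
        rcases h01 i₁ j with h1 | h1 <;> simp [h1]
      rw [Finset.sum_congr rfl fun j _ => hsq j]
      linarith
    · simpa using sum_mul_rows_le_one a h01 fun j₁ j₂ => h i₁ i₂ j₁ j₂ hi
  calc (∑ i, ∑ j, a i j) ^ 2 = (∑ j, ∑ i, a i j) ^ 2 := by rw [Finset.sum_comm]
    _ ≤ Fintype.card κ * ∑ j, (∑ i, a i j) ^ 2 := sq_sum_le_card_mul_sum_sq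
    _ = Fintype.card κ * ∑ i₁, ∑ i₂, ∑ j, a i₁ j * a i₂ j := by
      congr 1
      simp_rw [sq, Finset.sum_mul_sum]
      rw [Finset.sum_comm]
      exact Finset.sum_congr rfl fun i _ => Finset.sum_comm
    _ ≤ Fintype.card κ * ∑ i₁, ∑ i₂, ((if i₁ = i₂ then ∑ j, a i₁ j else 0) + 1) := by
      gcongr with i₁ _ i₂ _
      exact hpair i₁ i₂
    _ = Fintype.card κ * (∑ i, ∑ j, a i j + (Fintype.card ι : ℝ) ^ 2) := by
      simp [Finset.sum_add_distrib, sq]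

/-- an `M×M` 0-1 matrix in which no four entries positioned at the corners
of a combinatorial rectangle are all `1` has at most `3·M^{3/2}` ones. -/
theorem stmt18 (M : ℕ) (hM : 1 ≤ M) (a : Fin M → Fin M → ℝ)
    (h01 : ∀ i j, a i j = 0 ∨ a i j = 1)
    (h : ∀ i₁ i₂ j₁ j₂ : Fin M, i₁ ≠ i₂ → j₁ ≠ j₂ →
      ¬(a i₁ j₁ = 1 ∧ a i₁ j₂ = 1 ∧ a i₂ j₁ = 1 ∧ a i₂ j₂ = 1)) :
    ({p : Fin M × Fin M | a p.1 p.2 = 1}.ncard : ℝ) ≤ 3 * M * Real.sqrt M := by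
  classical
  have hcard : ({p : Fin M × Fin M | a p.1 p.2 = 1}.ncard : ℝ) = ∑ i, ∑ j, a i j := by
    have hind : ∀ p : Fin M × Fin M, a p.1 p.2 = if a p.1 p.2 = 1 then 1 else 0 := by
      intro p
      rcases h01 p.1 p.2 with h1 | h1 <;> simp [h1]
    rw [← Fintype.sum_prod_type', Finset.sum_congr rfl fun p _ => hind p, Finset.sum_boole,
      Set.ncard_eq_toFinset_card', Set.toFinset_ofPred]
  have key := sq_sum_le_of_rectangle_free a h01 h
  rw [Fintype.card_fin] at key
  rw [hcard]
  set S := ∑ i, ∑ j, a i j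
  have hM' : (1 : ℝ) ≤ M := by exact_mod_cast hM
  have hs : (1 : ℝ) ≤ Real.sqrt M := Real.one_le_sqrt.2 hM'
  have hss : Real.sqrt M * Real.sqrt M = M := Real.mul_self_sqrt (by positivity)
  set s := Real.sqrt M
  by_contra! hlt
  have hMs : (M : ℝ) ≤ M * s := le_mul_of_one_le_right (by positivity) hs
  have hsub : 2 * (M * s) ≤ S - M := by linarith
  have hS : 0 ≤ S := by linarith
  have hmul : 3 * M * s * (2 * (M * s)) ≤ S * (S - M) := by gcongr
  have hcube : 3 * M * s * (2 * (M * s)) = 6 * (M : ℝ) ^ 3 := by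
    calc 3 * M * s * (2 * (M * s)) = 6 * (M : ℝ) ^ 2 * (s * s) := by ring
      _ = 6 * (M : ℝ) ^ 3 := by rw [hss]; ring
  have hpos : (0 : ℝ) < (M : ℝ) ^ 3 := by positivity
  nlinarith
end

section
/- For every M ≥ 1 and all real numbers x_1,…,x_M and y_1,…,y_M, the number of pairs (i,j) ∈ {1,…,M}×{1,…,M} satisfying x_i + y_j = i·j is at most 3·M^{3/2}. -/
/-- Kővári–Sós–Turán counting: if no two distinct `a, a' ∈ A` have two distinct common neighbours
in `B` under the relation `r`, then the number `E` of related pairs in `A × B` satisfies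
`E ^ 2 ≤ |B| * (|A| ^ 2 + E)`. -/
theorem sq_sum_card_filter_le_of_no_rectangle {α β : Type*} [DecidableEq α]
    (A : Finset α) (B : Finset β) (r : α → β → Prop) [∀ a b, Decidable (r a b)]
    (h : ∀ a ∈ A, ∀ a' ∈ A, ∀ b ∈ B, ∀ b' ∈ B,
      r a b → r a' b → r a b' → r a' b' → a = a' ∨ b = b') :
    (∑ b ∈ B, (A.filter (r · b)).card) ^ 2 ≤
      B.card * (A.card ^ 2 + ∑ b ∈ B, (A.filter (r · b)).card) := by
  have hdisj : Set.PairwiseDisjoint (B : Set β) fun b => (A.filter (r · b)).offDiag := by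
    intro b hb b' hb' hne
    rw [Function.onFun, Finset.disjoint_left]
    rintro ⟨a, a'⟩ hp hp'
    simp only [Finset.mem_offDiag, Finset.mem_filter] at hp hp'
    rcases h a hp.1.1 a' hp.2.1.1 b hb b' hb' hp.1.2 hp.2.1.2 hp'.1.2 hp'.2.1.2 with h1 | h1
    · exact hp.2.2 h1
    · exact hne h1
  have hoff : ∑ b ∈ B, (A.filter (r · b)).offDiag.card ≤ A.card ^ 2 := by
    classical
    rw [← Finset.card_biUnion hdisj, sq, ← Finset.card_product]
    refine Finset.card_le_card fun p hp => ?_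
    simp only [Finset.mem_biUnion, Finset.mem_offDiag, Finset.mem_filter] at hp
    obtain ⟨b, -, h1, h2, -⟩ := hp
    exact Finset.mem_product.2 ⟨h1.1, h2.1⟩
  have hsq : ∑ b ∈ B, (A.filter (r · b)).card ^ 2 ≤
      A.card ^ 2 + ∑ b ∈ B, (A.filter (r · b)).card := by
    refine le_trans ?_ (Nat.add_le_add_right hoff _)
    rw [← Finset.sum_add_distrib]
    refine Finset.sum_le_sum fun b _ => ?_
    rw [Finset.offDiag_card, sq]
    omega
  exact sq_sum_le_card_mul_sum_sq.trans (Nat.mul_le_mul_left _ hsq)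

/-- for any reals `x₁,…,x_M`, `y₁,…,y_M`, the number of pairs
`(i,j) ∈ {1,…,M}²` with `xᵢ + yⱼ = i·j` is at most `3·M^{3/2}`. -/
theorem stmt19 (M : ℕ) (hM : 1 ≤ M) (x y : ℕ → ℝ) :
    (({p : ℕ × ℕ | 1 ≤ p.1 ∧ p.1 ≤ M ∧ 1 ≤ p.2 ∧ p.2 ≤ M ∧
        x p.1 + y p.2 = (p.1 * p.2 : ℕ)}.ncard : ℝ)) ≤ 3 * M * Real.sqrt M := by
  classical
  set S := {p : ℕ × ℕ | 1 ≤ p.1 ∧ p.1 ≤ M ∧ 1 ≤ p.2 ∧ p.2 ≤ M ∧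
    x p.1 + y p.2 = (p.1 * p.2 : ℕ)} with hS
  let r : ℕ → ℕ → Prop := fun i j => x i + y j = (i * j : ℕ)
  have hcard : S.ncard = ∑ j ∈ Finset.Icc 1 M, ((Finset.Icc 1 M).filter (r · j)).card := by
    have hSfin : S = ((Finset.Icc 1 M ×ˢ Finset.Icc 1 M).filter fun p => r p.1 p.2 :
        Finset (ℕ × ℕ)) := by
      ext p
      simp [hS, r, and_assoc]
    rw [hSfin, Set.ncard_coe_finset, Finset.card_filter, Finset.sum_product_right]
    simp only [Finset.card_filter]
  have key := sq_sum_card_filter_le_of_no_rectangle (Finset.Icc 1 M) (Finset.Icc 1 M) r (by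
    intro i _ i' _ j _ j' _ h1 h2 h3 h4
    simp only [r] at h1 h2 h3 h4
    push_cast at h1 h2 h3 h4
    have hprod : ((i : ℝ) - i') * ((j : ℝ) - j') = 0 := by linarith
    rcases mul_eq_zero.1 hprod with h | h
    · exact Or.inl (by exact_mod_cast sub_eq_zero.1 h)
    · exact Or.inr (by exact_mod_cast sub_eq_zero.1 h))
  rw [← hcard, Nat.card_Icc, Nat.add_sub_cancel] at key
  have keyR : (S.ncard : ℝ) ^ 2 ≤ M * ((M : ℝ) ^ 2 + S.ncard) := by exact_mod_cast key
  have hMR : (1 : ℝ) ≤ M := by exact_mod_cast hM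
  have hs1 : 1 ≤ √(M : ℝ) := Real.one_le_sqrt.2 hMR
  have hs2 : √(M : ℝ) ^ 2 = M := Real.sq_sqrt (by linarith)
  by_contra! hlt
  have hM3 : (3 * M * √(M : ℝ)) ^ 2 = 9 * (M : ℝ) ^ 3 := by rw [mul_pow, hs2]; ring
  have hbig : 9 * (M : ℝ) ^ 3 < (S.ncard : ℝ) ^ 2 := by
    rw [← hM3]
    exact pow_lt_pow_left₀ hlt (by positivity) two_ne_zero
  have hlin : 3 * (M : ℝ) ≤ S.ncard := by nlinarith
  nlinarith [mul_le_mul_of_nonneg_right hlin (Nat.cast_nonneg (α := ℝ) S.ncard),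
    pow_pos (lt_of_lt_of_le one_pos hMR) 3]
end
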